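/- arXiv:1108.2418 — 2 statements merged into one kernel-verified Lean document; each statement's English description precedes it below -/
import Mathlib

section
/- For the 2-vertex IFS on the unit interval, suppose h_v ≤ h_u and (a + g_u)(1 − a^s) ≥ b·a^s (so that H^s(F_u) = 1), and suppose g_u, g_v, a, b, c, d are multiplicatively rationally independent. Then the attractor F_u is not the attractor of any standard (1-vertex) IFS on ℝ, with or without separation conditions: there do not exist n ≥ 2 and contracting similarities T₁, …, T_n : ℝ → ℝ such that F_u = ⋃_{i=1}^{n} T_i(F_u). -/
open MeasureTheory
open scoped ENNReal NNReal

theorem rpow_weighted_le {s A q p : ℝ} (hs0 : 0 < s) (hs1 : s < 1) (hA0 : 0 ≤ A) (hA1 : A ≤ 1)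
    (hp : 0 ≤ p) (hq : 0 ≤ q) :
    A * p ^ s + (1 - A) * q ^ s ≤ (A * p + (1 - A) * q) ^ s := by
  have h := (Real.concaveOn_rpow hs0.le hs1.le).2 (x := p) (y := q) hp hq hA0
    (sub_nonneg.2 hA1) (by ring)
  simpa using h

theorem rpow_split_le {s α γ β A p q : ℝ} (hs0 : 0 < s) (hs1 : s < 1) (hα : α ≤ A)
    (hA0 : 0 ≤ A) (hβ0 : 0 ≤ β) (hβ : β ≤ 1 - A) (hsum : α + γ + β = 1) (hp : 0 ≤ p) (hq : 0 ≤ q)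
    (hp1 : p ≤ 1) (hq1 : q ≤ 1) :
    A * p ^ s + (1 - A) * q ^ s ≤ (α * p + γ + β * q) ^ s := by
  refine (rpow_weighted_le hs0 hs1 hA0 (by linarith) hp hq).trans ?_
  refine Real.rpow_le_rpow ?_ ?_ hs0.le
  · have : 0 ≤ 1 - A := by linarith
    positivity
  · nlinarith [mul_nonneg (sub_nonneg.2 hα) (sub_nonneg.2 hp1),
      mul_nonneg (sub_nonneg.2 hβ) (sub_nonneg.2 hq1)]

/-- One contraction step for the mass of an initial segment, the error term `e` shrinking to
`l * e`. -/
theorem initial_segment_step {s α γ β H H₁ H₂ t A l e : ℝ} {f f₁ f₂ : ℝ → ℝ}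
    (hs0 : 0 < s) (hs1 : s < 1) (hα : 0 < α) (hβ : 0 < β) (hsum : α + γ + β = 1)
    (hH : 0 ≤ H) (he : 0 ≤ e) (hαl : α ^ s ≤ l) (hβl : β ^ s ≤ l)
    (hH₁ : H₁ ≤ H) (htH : t ≤ H) (hA0 : 0 ≤ A) (hβA : β ≤ 1 - A)
    (hAt : α ^ s * t ≤ A * H) (hAH₂ : β ^ s * H₂ ≤ (1 - A) * H)
    (hleft : ∀ y, 0 ≤ y → y ≤ α → f y ≤ α ^ s * f₁ (y / α))
    (hmid : ∀ y, α ≤ y → y < α + γ → f y ≤ α ^ s * t)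
    (hright : ∀ y, α + γ ≤ y → y ≤ 1 → f y ≤ α ^ s * t + β ^ s * f₂ ((y - (α + γ)) / β))
    (hf₁ : ∀ y, 0 ≤ y → y ≤ 1 → f₁ y ≤ H₁ * y ^ s + e)
    (hf₂ : ∀ y, 0 ≤ y → y ≤ 1 → f₂ y ≤ H₂ * y ^ s + e)
    {y : ℝ} (hy0 : 0 ≤ y) (hy1 : y ≤ 1) : f y ≤ H * y ^ s + l * e := by
  have hαs : 0 < α ^ s := Real.rpow_pos_of_pos hα s
  have hβs : 0 < β ^ s := Real.rpow_pos_of_pos hβ s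
  have hl : 0 ≤ l * e := mul_nonneg (hαs.le.trans hαl) he
  rcases le_total y α with hyα | hyα
  · have h1 := hf₁ (y / α) (by positivity) ((div_le_one hα).2 hyα)
    rw [Real.div_rpow hy0 hα.le] at h1
    have h2 := mul_le_mul_of_nonneg_left h1 hαs.le
    have h3 : α ^ s * (H₁ * (y ^ s / α ^ s) + e) = H₁ * y ^ s + α ^ s * e := by
      field_simp
    have h4 := mul_le_mul_of_nonneg_right hαl he
    have h5 := mul_le_mul_of_nonneg_right hH₁ (Real.rpow_nonneg hy0 s)
    linarith [hleft y hy0 hyα]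
  rcases lt_or_ge y (α + γ) with hyγ | hyγ
  · have h1 := mul_le_mul_of_nonneg_left htH hαs.le
    have h2 := mul_le_mul_of_nonneg_right (Real.rpow_le_rpow hα.le hyα hs0.le) hH
    linarith [hmid y hyα hyγ]
  · set q := (y - (α + γ)) / β with hq
    have hq0 : 0 ≤ q := div_nonneg (by linarith) hβ.le
    have hq1 : q ≤ 1 := (div_le_one hβ).2 (by linarith)
    have h1 := mul_le_mul_of_nonneg_left (hf₂ q hq0 hq1) hβs.le
    have h2 := mul_le_mul_of_nonneg_right hβl he
    have h3 := mul_le_mul_of_nonneg_right hAH₂ (Real.rpow_nonneg hq0 s)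
    have h4 : A * 1 ^ s + (1 - A) * q ^ s ≤ (0 * 1 + (α + γ) + β * q) ^ s :=
      rpow_split_le hs0 hs1 hA0 hA0 hβ.le hβA (by linarith) zero_le_one hq0 le_rfl hq1
    rw [show 0 * 1 + (α + γ) + β * q = y by rw [hq]; field_simp; ring] at h4
    rw [Real.one_rpow] at h4
    have h5 := mul_le_mul_of_nonneg_left h4 hH
    have := hright y hyγ hy1
    nlinarith

/-- `U x y` behaves like the mass that a measure of total mass `h` on `[0, 1]` gives to
`[x, y]`. -/
structure IsIntervalMass (U : ℝ → ℝ → ℝ) (h : ℝ) : Prop where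
  eq_total : ∀ x y, x ≤ 0 → 1 ≤ y → U x y = h
  eq_zero_of_lt : ∀ x y, y < 0 → U x y = 0
  eq_zero_of_gt : ∀ x y, 1 < x → U x y = 0
  clamp_left : ∀ x y, x ≤ 0 → U x y = U 0 y
  clamp_right : ∀ x y, 1 ≤ y → U x y = U x 1
  le_mass : ∀ x y, U x y ≤ h

section IntervalMass

variable {s a g b h t : ℝ} {U V : ℝ → ℝ → ℝ}

theorem IsIntervalMass.initial_step (hU : IsIntervalMass U h) (hV : IsIntervalMass V t)
    (hs0 : 0 < s) (hs1 : s < 1) (ha : 0 < a) (hg : 0 < g) (hb : 0 < b) (hsum : a + g + b = 1)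
    (hh : 0 ≤ h) (heig : h = a ^ s * h + b ^ s * t) (hba : b ≤ 1 - a ^ s)
    (hrec : ∀ x y, U x y = a ^ s * U (x / a) (y / a) + b ^ s * V ((x - (a + g)) / b)
      ((y - (a + g)) / b))
    {l e : ℝ} (he : 0 ≤ e) (hal : a ^ s ≤ l) (hbl : b ^ s ≤ l)
    (hUe : ∀ y, 0 ≤ y → y ≤ 1 → U 0 y ≤ h * y ^ s + e)
    (hVe : ∀ y, 0 ≤ y → y ≤ 1 → V 0 y ≤ t * y ^ s + e)
    {y : ℝ} (hy0 : 0 ≤ y) (hy1 : y ≤ 1) : U 0 y ≤ h * y ^ s + l * e := by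
  have has : 0 < a ^ s := Real.rpow_pos_of_pos ha s
  have hbs : 0 < b ^ s := Real.rpow_pos_of_pos hb s
  refine initial_segment_step (f := U 0) (f₁ := U 0) (f₂ := V 0) (t := h) (A := a ^ s)
    hs0 hs1 ha hb hsum hh he hal hbl le_rfl le_rfl has.le hba le_rfl (by linarith)
    ?_ ?_ ?_ hUe hVe hy0 hy1
  · intro y _ hya
    rw [hrec, hV.eq_zero_of_lt _ _ (div_neg_of_neg_of_pos (by linarith) hb)]
    simp
  · intro y hya hyg
    rw [hrec, zero_div]
    have h1 := mul_le_mul_of_nonneg_left (hU.le_mass 0 (y / a)) has.le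
    rw [hV.eq_zero_of_lt _ ((y - (a + g)) / b) (div_neg_of_neg_of_pos (by linarith) hb)]
    linarith
  · intro y hyg _
    rw [hrec, zero_div, hU.eq_total 0 (y / a) le_rfl ((one_le_div ha).2 (by linarith)),
      hV.clamp_left _ _ (div_nonpos_of_nonpos_of_nonneg (by linarith) hb.le)]

theorem IsIntervalMass.final_step (hU : IsIntervalMass U h) (hV : IsIntervalMass V t)
    (hs0 : 0 < s) (hs1 : s < 1) (ha : 0 < a) (hg : 0 < g) (hb : 0 < b) (hsum : a + g + b = 1)
    {M : ℝ} (hM : 0 ≤ M) (hhM : h ≤ M) (htM : t ≤ M) (heig : h = a ^ s * h + b ^ s * t)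
    (hrec : ∀ x y, U x y = a ^ s * U (x / a) (y / a) + b ^ s * V ((x - (a + g)) / b)
      ((y - (a + g)) / b))
    {l e : ℝ} (he : 0 ≤ e) (hal : a ^ s ≤ l) (hbl : b ^ s ≤ l)
    (hUe : ∀ y, 0 ≤ y → y ≤ 1 → U (1 - y) 1 ≤ M * y ^ s + e)
    (hVe : ∀ y, 0 ≤ y → y ≤ 1 → V (1 - y) 1 ≤ M * y ^ s + e)
    {y : ℝ} (hy0 : 0 ≤ y) (hy1 : y ≤ 1) : U (1 - y) 1 ≤ M * y ^ s + l * e := by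
  have hbs : 0 < b ^ s := Real.rpow_pos_of_pos hb s
  have has1 : a ^ s ≤ 1 := Real.rpow_le_one ha.le (by linarith) hs0.le
  have haas : a ≤ a ^ s := Real.self_le_rpow_of_le_one ha.le (by linarith) hs1.le
  have hend : (1 - (a + g)) / b = 1 := by rw [div_eq_one_iff_eq hb.ne']; linarith
  have hbt : b ^ s * t ≤ (1 - a ^ s) * M := by
    have := mul_le_mul_of_nonneg_left hhM (sub_nonneg.2 has1)
    linarith
  refine initial_segment_step (f := fun y => U (1 - y) 1) (f₁ := fun y => V (1 - y) 1)
    (f₂ := fun y => U (1 - y) 1) (t := t) (A := 1 - a ^ s) (γ := g)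
    hs0 hs1 hb ha (by linarith) hM he hbl hal le_rfl htM (by linarith) (by linarith) hbt
    (by linarith) ?_ ?_ ?_ hVe hUe hy0 hy1
  · intro y _ hyb
    rw [hrec, hU.eq_zero_of_gt _ _ ((one_lt_div ha).2 (by linarith)), hend,
      show (1 - y - (a + g)) / b = 1 - y / b by field_simp; linarith]
    simp
  · intro y hyb hyg
    rw [hrec, hU.eq_zero_of_gt _ _ ((one_lt_div ha).2 (by linarith)), hend]
    have := mul_le_mul_of_nonneg_left (hV.le_mass ((1 - y - (a + g)) / b) 1) hbs.le
    linarith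
  · intro y hyg _
    rw [hrec, hend, hV.eq_total _ 1 (div_nonpos_of_nonpos_of_nonneg (by linarith) hb.le) le_rfl,
      hU.clamp_right _ _ ((one_le_div ha).2 (by linarith)),
      show (1 - y) / a = 1 - (y - (b + g)) / a by field_simp; linarith]
    linarith

theorem IsIntervalMass.interval_step (hU : IsIntervalMass U h) (hV : IsIntervalMass V t)
    (hs0 : 0 < s) (hs1 : s < 1) (ha : 0 < a) (hg : 0 < g) (hb : 0 < b) (hsum : a + g + b = 1)
    {M : ℝ} (hM : 0 ≤ M) (hhM : h ≤ M) (heig : h = a ^ s * h + b ^ s * t) (hba : b ≤ 1 - a ^ s)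
    (hrec : ∀ x y, U x y = a ^ s * U (x / a) (y / a) + b ^ s * V ((x - (a + g)) / b)
      ((y - (a + g)) / b))
    (hUfinal : ∀ y, 0 ≤ y → y ≤ 1 → U (1 - y) 1 ≤ M * y ^ s)
    (hVinitial : ∀ y, 0 ≤ y → y ≤ 1 → V 0 y ≤ t * y ^ s)
    {l e : ℝ} (he : 0 ≤ e) (hal : a ^ s ≤ l) (hbl : b ^ s ≤ l)
    (hUe : ∀ x y, x ≤ y → U x y ≤ M * (y - x) ^ s + e)
    (hVe : ∀ x y, x ≤ y → V x y ≤ M * (y - x) ^ s + e)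
    {x y : ℝ} (hxy : x ≤ y) : U x y ≤ M * (y - x) ^ s + l * e := by
  have has : 0 < a ^ s := Real.rpow_pos_of_pos ha s
  have hbs : 0 < b ^ s := Real.rpow_pos_of_pos hb s
  have has1 : a ^ s ≤ 1 := Real.rpow_le_one ha.le (by linarith) hs0.le
  have haas : a ≤ a ^ s := Real.self_le_rpow_of_le_one ha.le (by linarith) hs1.le
  have hae := mul_le_mul_of_nonneg_right hal he
  have hbe := mul_le_mul_of_nonneg_right hbl he
  rw [hrec]
  rcases lt_or_ge y (a + g) with hy | hy
  · rw [hV.eq_zero_of_lt _ _ (div_neg_of_neg_of_pos (by linarith) hb)]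
    have h1 := hUe (x / a) (y / a) (div_le_div_of_nonneg_right hxy ha.le)
    rw [← sub_div, Real.div_rpow (by linarith) ha.le] at h1
    have h2 := mul_le_mul_of_nonneg_left h1 has.le
    have h3 : a ^ s * (M * ((y - x) ^ s / a ^ s) + e) = M * (y - x) ^ s + a ^ s * e := by
      field_simp
    linarith
  rcases lt_or_ge a x with hx | hx
  · rw [hU.eq_zero_of_gt _ _ ((one_lt_div ha).2 hx)]
    have h1 := hVe ((x - (a + g)) / b) ((y - (a + g)) / b)
      (div_le_div_of_nonneg_right (by linarith) hb.le)
    rw [← sub_div, sub_sub_sub_cancel_right, Real.div_rpow (by linarith) hb.le] at h1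
    have h2 := mul_le_mul_of_nonneg_left h1 hbs.le
    have h3 : b ^ s * (M * ((y - x) ^ s / b ^ s) + e) = M * (y - x) ^ s + b ^ s * e := by
      field_simp
    linarith
  · rw [hU.clamp_right _ _ ((one_le_div ha).2 (by linarith)),
      hV.clamp_left _ _ (div_nonpos_of_nonpos_of_nonneg (by linarith) hb.le)]
    obtain ⟨p, hp0, hp1, hpx, hUp⟩ : ∃ p, 0 ≤ p ∧ p ≤ 1 ∧ a * p ≤ a - x ∧
        U (x / a) 1 ≤ M * p ^ s := by
      rcases le_total x 0 with hx0 | hx0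
      · refine ⟨1, zero_le_one, le_rfl, by linarith, ?_⟩
        rw [Real.one_rpow]
        linarith [hU.le_mass (x / a) 1]
      · have h1 : x / a ≤ 1 := (div_le_one ha).2 hx
        have h0 : 0 ≤ x / a := by positivity
        refine ⟨1 - x / a, by linarith, by linarith, ?_, ?_⟩
        · rw [mul_sub, mul_div_cancel₀ _ ha.ne', mul_one]
        · simpa using hUfinal (1 - x / a) (by linarith) (by linarith)
    obtain ⟨q, hq0, hq1, hqy, hVq⟩ : ∃ q, 0 ≤ q ∧ q ≤ 1 ∧ b * q ≤ y - (a + g) ∧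
        V 0 ((y - (a + g)) / b) ≤ t * q ^ s := by
      have h0 : 0 ≤ (y - (a + g)) / b := div_nonneg (by linarith) hb.le
      rcases le_total ((y - (a + g)) / b) 1 with hy1 | hy1
      · refine ⟨(y - (a + g)) / b, h0, hy1, ?_, hVinitial _ h0 hy1⟩
        rw [mul_div_cancel₀ _ hb.ne']
      · refine ⟨1, zero_le_one, le_rfl, ?_, ?_⟩
        · linarith [(one_le_div hb).1 hy1]
        · rw [Real.one_rpow, mul_one]
          exact hV.le_mass _ _
    have h1 := mul_le_mul_of_nonneg_left hUp has.le
    have h2 := mul_le_mul_of_nonneg_left hVq hbs.le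
    have h3 : b ^ s * (t * q ^ s) ≤ (1 - a ^ s) * M * q ^ s := by
      rw [← mul_assoc]
      refine mul_le_mul_of_nonneg_right ?_ (Real.rpow_nonneg hq0 s)
      have := mul_le_mul_of_nonneg_left hhM (sub_nonneg.2 has1)
      linarith
    have h4 := rpow_split_le hs0 hs1 haas has.le hb.le hba hsum hp0 hq0 hp1 hq1
    have h5 : (a * p + g + b * q) ^ s ≤ (y - x) ^ s :=
      Real.rpow_le_rpow (by positivity) (by linarith) hs0.le
    have h6 := mul_le_mul_of_nonneg_left (h4.trans h5) hM
    have h7 : 0 ≤ l * e := mul_nonneg (has.le.trans hal) he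
    nlinarith

theorem le_of_forall_le_add_mul_pow {x z C l : ℝ} (hl0 : 0 ≤ l) (hl1 : l < 1)
    (h : ∀ n : ℕ, x ≤ z + C * l ^ n) : x ≤ z := by
  have hlim : Filter.Tendsto (fun n : ℕ => z + C * l ^ n) Filter.atTop (nhds (z + C * 0)) :=
    ((tendsto_pow_atTop_nhds_zero_of_lt_one hl0 hl1).const_mul C).const_add z
  simpa using ge_of_tendsto' hlim h

end IntervalMass

/-- The mass that the first of two mutually recursive interval masses gives to an interval is
at most its total mass times the `s`-th power of the length. -/
theorem interval_mass_le {s a gu b c gv d hu hv : ℝ} {U V : ℝ → ℝ → ℝ}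
    (hs0 : 0 < s) (hs1 : s < 1)
    (ha : 0 < a) (hgu : 0 < gu) (hb : 0 < b) (hc : 0 < c) (hgv : 0 < gv) (hd : 0 < d)
    (hsum1 : a + gu + b = 1) (hsum2 : c + gv + d = 1) (hhv0 : 0 < hv) (hvu : hv ≤ hu)
    (heigu : hu = a ^ s * hu + b ^ s * hv) (heigv : hv = d ^ s * hu + c ^ s * hv)
    (hba : b ≤ 1 - a ^ s)
    (hU : IsIntervalMass U hu) (hV : IsIntervalMass V hv)
    (hUrec : ∀ x y, U x y = a ^ s * U (x / a) (y / a) + b ^ s * V ((x - (a + gu)) / b)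
      ((y - (a + gu)) / b))
    (hVrec : ∀ x y, V x y = c ^ s * V (x / c) (y / c) + d ^ s * U ((x - (c + gv)) / d)
      ((y - (c + gv)) / d))
    {x y : ℝ} (hxy : x ≤ y) : U x y ≤ hu * (y - x) ^ s := by
  have hhu0 : 0 < hu := hhv0.trans_le hvu
  have heigv' : hv = c ^ s * hv + d ^ s * hu := by linarith
  have hdc : d ≤ 1 - c ^ s := by
    have hdd : d ≤ d ^ s := Real.self_le_rpow_of_le_one hd.le (by linarith) hs1.le
    have h1 := mul_le_mul_of_nonneg_left hvu (Real.rpow_nonneg hd.le s)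
    have h2 : d ^ s * hv ≤ (1 - c ^ s) * hv := by linarith
    exact hdd.trans (le_of_mul_le_mul_right h2 hhv0)
  obtain ⟨l, hl0, hl1, hal, hbl, hcl, hdl⟩ : ∃ l : ℝ, 0 ≤ l ∧ l < 1 ∧ a ^ s ≤ l ∧ b ^ s ≤ l ∧
      c ^ s ≤ l ∧ d ^ s ≤ l := by
    refine ⟨max (max (a ^ s) (b ^ s)) (max (c ^ s) (d ^ s)), by positivity, ?_, by simp, by simp,
      by simp, by simp⟩
    refine max_lt (max_lt ?_ ?_) (max_lt ?_ ?_) <;>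
      exact Real.rpow_lt_one (by linarith) (by linarith) hs0
  have hpow (n : ℕ) : 0 ≤ hu * l ^ n := by positivity
  have hstep (n : ℕ) : l * (hu * l ^ n) = hu * l ^ (n + 1) := by ring
  have hinitial (n : ℕ) : (∀ y, 0 ≤ y → y ≤ 1 → U 0 y ≤ hu * y ^ s + hu * l ^ n) ∧
      ∀ y, 0 ≤ y → y ≤ 1 → V 0 y ≤ hv * y ^ s + hu * l ^ n := by
    induction n with
    | zero =>
      refine ⟨fun y hy _ => ?_, fun y hy _ => ?_⟩
      · have : 0 ≤ hu * y ^ s := by positivity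
        linarith [hU.le_mass 0 y]
      · have : 0 ≤ hv * y ^ s := by positivity
        linarith [hV.le_mass 0 y]
    | succ n ih =>
      rw [← hstep]
      exact ⟨fun y => hU.initial_step hV hs0 hs1 ha hgu hb hsum1 hhu0.le heigu hba hUrec (hpow n)
          hal hbl ih.1 ih.2,
        fun y => hV.initial_step hU hs0 hs1 hc hgv hd hsum2 hhv0.le heigv' hdc hVrec (hpow n)
          hcl hdl ih.2 ih.1⟩
  have hfinal (n : ℕ) : (∀ y, 0 ≤ y → y ≤ 1 → U (1 - y) 1 ≤ hu * y ^ s + hu * l ^ n) ∧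
      ∀ y, 0 ≤ y → y ≤ 1 → V (1 - y) 1 ≤ hu * y ^ s + hu * l ^ n := by
    induction n with
    | zero =>
      refine ⟨fun y hy _ => ?_, fun y hy _ => ?_⟩ <;> have : 0 ≤ hu * y ^ s := by positivity
      · linarith [hU.le_mass (1 - y) 1]
      · linarith [hV.le_mass (1 - y) 1]
    | succ n ih =>
      rw [← hstep]
      exact ⟨fun y => hU.final_step hV hs0 hs1 ha hgu hb hsum1 hhu0.le le_rfl hvu heigu hUrec
          (hpow n) hal hbl ih.1 ih.2,
        fun y => hV.final_step hU hs0 hs1 hc hgv hd hsum2 hhu0.le hvu le_rfl heigv' hVrec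
          (hpow n) hcl hdl ih.2 ih.1⟩
  have hinitialU (y : ℝ) (hy0 : 0 ≤ y) (hy1 : y ≤ 1) : U 0 y ≤ hu * y ^ s :=
    le_of_forall_le_add_mul_pow hl0 hl1 fun n => (hinitial n).1 y hy0 hy1
  have hinitialV (y : ℝ) (hy0 : 0 ≤ y) (hy1 : y ≤ 1) : V 0 y ≤ hv * y ^ s :=
    le_of_forall_le_add_mul_pow hl0 hl1 fun n => (hinitial n).2 y hy0 hy1
  have hfinalU (y : ℝ) (hy0 : 0 ≤ y) (hy1 : y ≤ 1) : U (1 - y) 1 ≤ hu * y ^ s :=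
    le_of_forall_le_add_mul_pow hl0 hl1 fun n => (hfinal n).1 y hy0 hy1
  have hfinalV (y : ℝ) (hy0 : 0 ≤ y) (hy1 : y ≤ 1) : V (1 - y) 1 ≤ hu * y ^ s :=
    le_of_forall_le_add_mul_pow hl0 hl1 fun n => (hfinal n).2 y hy0 hy1
  have hinterval (n : ℕ) : (∀ x y, x ≤ y → U x y ≤ hu * (y - x) ^ s + hu * l ^ n) ∧
      ∀ x y, x ≤ y → V x y ≤ hu * (y - x) ^ s + hu * l ^ n := by
    induction n with
    | zero =>
      refine ⟨fun x y hxy => ?_, fun x y hxy => ?_⟩ <;>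
        have : 0 ≤ hu * (y - x) ^ s := mul_nonneg hhu0.le (Real.rpow_nonneg (by linarith) s)
      · linarith [hU.le_mass x y]
      · linarith [hV.le_mass x y]
    | succ n ih =>
      rw [← hstep]
      exact ⟨fun x y => hU.interval_step hV hs0 hs1 ha hgu hb hsum1 hhu0.le le_rfl heigu hba hUrec
          hfinalU hinitialV (hpow n) hal hbl ih.1 ih.2,
        fun x y => hV.interval_step hU hs0 hs1 hc hgv hd hsum2 hhu0.le hvu heigv' hdc hVrec
          hfinalV hinitialU (hpow n) hcl hdl ih.2 ih.1⟩
  exact le_of_forall_le_add_mul_pow hl0 hl1 fun n => (hinterval n).1 x y hxy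


open scoped Pointwise in
theorem hausdorffMeasure_affine_image {s r : ℝ} (hs : 0 ≤ s) (hr : r ≠ 0) (t : ℝ) (S : Set ℝ) :
    μH[s] ((fun x => r * x + t) '' S) = ENNReal.ofReal (|r| ^ s) * μH[s] S := by
  have hcomp : (fun x => r * x + t) '' S = (fun x => x + t) '' (r • S) := by
    rw [← Set.image_smul, Set.image_image]
    rfl
  have hiso : Isometry fun x : ℝ => x + t := isometry_add_right t
  rw [hcomp, hiso.hausdorffMeasure_image (Or.inl hs), Measure.hausdorffMeasure_smul₀ hs hr,
    ENNReal.smul_def, smul_eq_mul]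
  congr 1
  rw [← Real.norm_eq_abs, ENNReal.ofReal, Real.toNNReal_rpow_of_nonneg (norm_nonneg r),
    norm_toNNReal]

/-- The `s`-dimensional Hausdorff measure of `F ∩ [x, y]`, as a real number. -/
noncomputable def intervalMass (s : ℝ) (F : Set ℝ) (x y : ℝ) : ℝ :=
  (μH[s] (F ∩ Set.Icc x y)).toReal

section HausdorffMass

variable {s h : ℝ} {F : Set ℝ}

theorem hausdorffMeasure_inter_ne_top (hF : μH[s] F = ENNReal.ofReal h) (S : Set ℝ) :
    μH[s] (F ∩ S) ≠ ∞ :=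
  ((measure_mono Set.inter_subset_left).trans_lt (hF ▸ ENNReal.ofReal_lt_top)).ne

theorem intervalMass_mono (hF : μH[s] F = ENNReal.ofReal h) {x y x' y' : ℝ} (hx : x' ≤ x)
    (hy : y ≤ y') : intervalMass s F x y ≤ intervalMass s F x' y' :=
  ENNReal.toReal_mono (hausdorffMeasure_inter_ne_top hF _)
    (measure_mono (Set.inter_subset_inter_right F (Set.Icc_subset_Icc hx hy)))

theorem isIntervalMass_intervalMass (hF : μH[s] F = ENNReal.ofReal h) (hh : 0 ≤ h)
    (hsub : F ⊆ Set.Icc 0 1) : IsIntervalMass (intervalMass s F) h where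
  eq_total x y hx hy := by
    rw [intervalMass, Set.inter_eq_left.2 (hsub.trans (Set.Icc_subset_Icc hx hy)), hF,
      ENNReal.toReal_ofReal hh]
  eq_zero_of_lt x y hy := by
    have : F ∩ Set.Icc x y = ∅ := by
      ext z
      simp only [Set.mem_inter_iff, Set.mem_Icc, Set.mem_empty_iff_false, iff_false]
      rintro ⟨hz, -, hzy⟩
      linarith [(hsub hz).1]
    simp [intervalMass, this]
  eq_zero_of_gt x y hx := by
    have : F ∩ Set.Icc x y = ∅ := by
      ext z
      simp only [Set.mem_inter_iff, Set.mem_Icc, Set.mem_empty_iff_false, iff_false]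
      rintro ⟨hz, hzx, -⟩
      linarith [(hsub hz).2]
    simp [intervalMass, this]
  clamp_left x y hx := by
    have : F ∩ Set.Icc x y = F ∩ Set.Icc 0 y := by
      ext z
      simp only [Set.mem_inter_iff, Set.mem_Icc]
      exact ⟨fun hz => ⟨hz.1, (hsub hz.1).1, hz.2.2⟩, fun hz => ⟨hz.1, hx.trans hz.2.1, hz.2.2⟩⟩
    simp [intervalMass, this]
  clamp_right x y hy := by
    have : F ∩ Set.Icc x y = F ∩ Set.Icc x 1 := by
      ext z
      simp only [Set.mem_inter_iff, Set.mem_Icc]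
      exact ⟨fun hz => ⟨hz.1, hz.2.1, (hsub hz.1).2⟩, fun hz => ⟨hz.1, hz.2.1, hz.2.2.trans hy⟩⟩
    simp [intervalMass, this]
  le_mass x y := by
    rw [← ENNReal.toReal_ofReal hh, ← hF]
    exact ENNReal.toReal_mono (hF ▸ ENNReal.ofReal_ne_top) (measure_mono Set.inter_subset_left)

theorem image_affine_inter_Icc {r : ℝ} (hr : 0 < r) (k x y : ℝ) :
    (fun z => r * z + k) '' F ∩ Set.Icc x y =
      (fun z => r * z + k) '' (F ∩ Set.Icc ((x - k) / r) ((y - k) / r)) := by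
  ext z
  simp only [Set.mem_inter_iff, Set.mem_image, Set.mem_Icc]
  constructor
  · rintro ⟨⟨w, hw, rfl⟩, hx, hy⟩
    refine ⟨w, ⟨hw, ?_, ?_⟩, rfl⟩
    · rw [div_le_iff₀ hr]; linarith
    · rw [le_div_iff₀ hr]; linarith
  · rintro ⟨w, ⟨hw, hx, hy⟩, rfl⟩
    rw [div_le_iff₀ hr] at hx
    rw [le_div_iff₀ hr] at hy
    exact ⟨⟨w, hw, rfl⟩, by linarith, by linarith⟩

theorem intervalMass_rec {a b k h₁ h₂ : ℝ} {F₁ F₂ : Set ℝ} (hs : 0 ≤ s) (ha : 0 < a) (hb : 0 < b)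
    (hak : a < k) (hF₂ : IsCompact F₂) (hsub₁ : F₁ ⊆ Set.Icc 0 1) (hsub₂ : F₂ ⊆ Set.Icc 0 1)
    (hμ₁ : μH[s] F₁ = ENNReal.ofReal h₁) (hμ₂ : μH[s] F₂ = ENNReal.ofReal h₂)
    (hF : F = (fun x => a * x) '' F₁ ∪ (fun x => b * x + k) '' F₂) (x y : ℝ) :
    intervalMass s F x y = a ^ s * intervalMass s F₁ (x / a) (y / a) +
      b ^ s * intervalMass s F₂ ((x - k) / b) ((y - k) / b) := by
  have ha' : (fun x => a * x) = fun x : ℝ => a * x + 0 := by simp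
  have hdisj : Disjoint ((fun x => a * x + 0) '' (F₁ ∩ Set.Icc ((x - 0) / a) ((y - 0) / a)))
      ((fun x => b * x + k) '' (F₂ ∩ Set.Icc ((x - k) / b) ((y - k) / b))) := by
    rw [Set.disjoint_left]
    rintro _ ⟨z, ⟨hz, -⟩, rfl⟩ ⟨w, ⟨hw, -⟩, hzw⟩
    have h1 := mul_le_mul_of_nonneg_left (hsub₁ hz).2 ha.le
    have h2 := mul_nonneg hb.le (hsub₂ hw).1
    simp only at hzw
    linarith
  have hmeas : MeasurableSet
      ((fun x => b * x + k) '' (F₂ ∩ Set.Icc ((x - k) / b) ((y - k) / b))) :=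
    ((hF₂.inter_right isClosed_Icc).image (by fun_prop)).isClosed.measurableSet
  rw [intervalMass, hF, Set.union_inter_distrib_right, ha', image_affine_inter_Icc ha,
    image_affine_inter_Icc hb, measure_union hdisj hmeas, hausdorffMeasure_affine_image hs ha.ne',
    hausdorffMeasure_affine_image hs hb.ne', ENNReal.toReal_add, ENNReal.toReal_mul,
    ENNReal.toReal_mul, ENNReal.toReal_ofReal (by positivity),
    ENNReal.toReal_ofReal (by positivity), abs_of_pos ha, abs_of_pos hb, sub_zero, sub_zero,
    intervalMass, intervalMass]
  · exact ENNReal.mul_ne_top ENNReal.ofReal_ne_top (hausdorffMeasure_inter_ne_top hμ₁ _)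
  · exact ENNReal.mul_ne_top ENNReal.ofReal_ne_top (hausdorffMeasure_inter_ne_top hμ₂ _)

theorem intervalMass_pos_step {a b k : ℝ} {F₁ F₂ : Set ℝ} (ha : 0 < a) (hb : 0 < b)
    (hF : F = (fun x => a * x) '' F₁ ∪ (fun x => b * x + k) '' F₂)
    (hrec : ∀ x y, intervalMass s F x y = a ^ s * intervalMass s F₁ (x / a) (y / a) +
      b ^ s * intervalMass s F₂ ((x - k) / b) ((y - k) / b))
    {l e : ℝ} (hal : a ≤ l) (hbl : b ≤ l) (he : 0 < e)
    (h₁ : ∀ ε, e ≤ ε → ∀ z ∈ F₁, 0 < intervalMass s F₁ (z - ε) (z + ε))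
    (h₂ : ∀ ε, e ≤ ε → ∀ z ∈ F₂, 0 < intervalMass s F₂ (z - ε) (z + ε))
    {ε : ℝ} (hε : l * e ≤ ε) {z : ℝ} (hz : z ∈ F) :
    0 < intervalMass s F (z - ε) (z + ε) := by
  have has : 0 < a ^ s := Real.rpow_pos_of_pos ha s
  have hbs : 0 < b ^ s := Real.rpow_pos_of_pos hb s
  rw [hrec]
  rw [hF] at hz
  rcases hz with ⟨w, hw, rfl⟩ | ⟨w, hw, rfl⟩ <;> dsimp only
  · refine add_pos_of_pos_of_nonneg (mul_pos has ?_) (mul_nonneg hbs.le ENNReal.toReal_nonneg)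
    rw [sub_div, add_div, mul_div_cancel_left₀ _ ha.ne']
    exact h₁ (ε / a) ((le_div_iff₀ ha).2 (by nlinarith)) w hw
  · refine add_pos_of_nonneg_of_pos (mul_nonneg has.le ENNReal.toReal_nonneg) (mul_pos hbs ?_)
    rw [show (b * w + k - ε - k) / b = w - ε / b by field_simp; ring,
      show (b * w + k + ε - k) / b = w + ε / b by field_simp; ring]
    exact h₂ (ε / b) ((le_div_iff₀ hb).2 (by nlinarith)) w hw

/-- If the affine image of `F` lies in `F` and has the largest mass its diameter allows, then it
is all of `F` between the images of `0` and `1`. -/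
theorem mem_image_affine_of_mem_uIcc (hs : 0 ≤ s) (hFc : IsCompact F) (h0 : (0 : ℝ) ∈ F)
    (h1 : (1 : ℝ) ∈ F) (hh : 0 ≤ h) (hμ : μH[s] F = ENNReal.ofReal h)
    (hle : ∀ x y, x ≤ y → intervalMass s F x y ≤ h * (y - x) ^ s)
    (hpos : ∀ ε, 0 < ε → ∀ z ∈ F, 0 < intervalMass s F (z - ε) (z + ε))
    {r t : ℝ} (hr : r ≠ 0) (hsub : ∀ x ∈ F, r * x + t ∈ F) (hF01 : F ⊆ Set.Icc 0 1)
    {z : ℝ} (hz : z ∈ F) (hzI : z ∈ Set.uIcc t (r + t)) : ∃ x ∈ F, r * x + t = z := by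
  by_contra hne
  have hTc : IsClosed ((fun x => r * x + t) '' F) := (hFc.image (by fun_prop)).isClosed
  have hnot : z ∈ ((fun x => r * x + t) '' F)ᶜ := hne
  obtain ⟨ε, hε, hball⟩ := Metric.isOpen_iff.1 hTc.isOpen_compl z hnot
  have hfar (x : ℝ) (hx : x ∈ F) : ε ≤ |r * x + t - z| := by
    by_contra! hlt
    exact hball (Metric.mem_ball.2 ((Real.dist_eq _ _).trans_lt hlt)) ⟨x, hx, rfl⟩
  set p := min t (r + t) with hp
  set q := max t (r + t) with hq
  have hpq : q - p = |r| := by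
    rw [hp, hq, max_sub_min_eq_abs]
    congr 1
    ring
  have hzp : p + ε ≤ z := by
    have hz1 : p ≤ z := hzI.1
    have : ε ≤ |p - z| := by
      rcases min_choice t (r + t) with h | h <;> rw [hp, h]
      · simpa using hfar 0 h0
      · simpa using hfar 1 h1
    rw [abs_of_nonpos (by linarith)] at this
    linarith
  have hzq : z + ε ≤ q := by
    have hz1 : z ≤ q := hzI.2
    have : ε ≤ |q - z| := by
      rcases max_choice t (r + t) with h | h <;> rw [hq, h]
      · simpa using hfar 0 h0
      · simpa using hfar 1 h1
    rw [abs_of_nonneg (by linarith)] at this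
    linarith
  have hdisj : Disjoint ((fun x => r * x + t) '' F)
      (F ∩ Set.Icc (z - ε / 2) (z + ε / 2)) := by
    rw [Set.disjoint_left]
    rintro _ ⟨x, hx, rfl⟩ ⟨-, hx1, hx2⟩
    have := hfar x hx
    rcases abs_cases (r * x + t - z) with h | h <;> simp only at hx1 hx2 <;> linarith
  have hunion : (fun x => r * x + t) '' F ∪ F ∩ Set.Icc (z - ε / 2) (z + ε / 2) ⊆
      F ∩ Set.Icc p q := by
    rintro w (⟨x, hx, rfl⟩ | ⟨hw, hw1, hw2⟩)
    · refine ⟨hsub x hx, ?_⟩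
      obtain ⟨hx0, hx1⟩ := hF01 hx
      rcases lt_or_gt_of_ne hr with hr | hr
      · constructor
        · exact (min_le_right _ _).trans (by simp only; nlinarith)
        · exact le_trans (by simp only; nlinarith) (le_max_left _ _)
      · constructor
        · exact (min_le_left _ _).trans (by simp only; nlinarith)
        · exact le_trans (by simp only; nlinarith) (le_max_right _ _)
    · exact ⟨hw, by linarith, by linarith⟩
  have hmeas : MeasurableSet (F ∩ Set.Icc (z - ε / 2) (z + ε / 2)) :=
    hFc.isClosed.measurableSet.inter measurableSet_Icc
  have hμle := measure_mono (μ := μH[s]) hunion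
  rw [measure_union hdisj hmeas, hausdorffMeasure_affine_image hs hr, hμ] at hμle
  have hreal := ENNReal.toReal_mono (hausdorffMeasure_inter_ne_top hμ _) hμle
  rw [ENNReal.toReal_add (ENNReal.mul_ne_top ENNReal.ofReal_ne_top ENNReal.ofReal_ne_top)
    (hausdorffMeasure_inter_ne_top hμ _), ENNReal.toReal_mul, ENNReal.toReal_ofReal hh,
    ENNReal.toReal_ofReal (by positivity)] at hreal
  have h2 := hle p q min_le_max
  rw [hpq] at h2
  have h3 := hpos (ε / 2) (by positivity) z hz
  unfold intervalMass at h2 h3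
  linarith

end HausdorffMass

theorem intervalMass_pos {s a k b c m d hu hv : ℝ} {F G : Set ℝ}
    (ha : 0 < a) (hb : 0 < b) (hc : 0 < c) (hd : 0 < d)
    (ha1 : a < 1) (hb1 : b < 1) (hc1 : c < 1) (hd1 : d < 1)
    (hF01 : F ⊆ Set.Icc 0 1) (hG01 : G ⊆ Set.Icc 0 1) (hu0 : 0 < hu) (hv0 : 0 < hv)
    (hF : F = (fun x => a * x) '' F ∪ (fun x => b * x + k) '' G)
    (hG : G = (fun x => c * x) '' G ∪ (fun x => d * x + m) '' F)
    (hUmass : IsIntervalMass (intervalMass s F) hu) (hVmass : IsIntervalMass (intervalMass s G) hv)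
    (hFrec : ∀ x y, intervalMass s F x y = a ^ s * intervalMass s F (x / a) (y / a) +
      b ^ s * intervalMass s G ((x - k) / b) ((y - k) / b))
    (hGrec : ∀ x y, intervalMass s G x y = c ^ s * intervalMass s G (x / c) (y / c) +
      d ^ s * intervalMass s F ((x - m) / d) ((y - m) / d))
    (ε : ℝ) (hε : 0 < ε) (z : ℝ) (hz : z ∈ F) : 0 < intervalMass s F (z - ε) (z + ε) := by
  obtain ⟨l, hl0, hl1, hal, hbl, hcl, hdl⟩ : ∃ l : ℝ, 0 < l ∧ l < 1 ∧ a ≤ l ∧ b ≤ l ∧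
      c ≤ l ∧ d ≤ l :=
    ⟨max (max a b) (max c d), by positivity, by simp [*], by simp, by simp, by simp, by simp⟩
  have hstep (n : ℕ) : l * l ^ n = l ^ (n + 1) := by ring
  have key (n : ℕ) : (∀ ε, l ^ n ≤ ε → ∀ z ∈ F, 0 < intervalMass s F (z - ε) (z + ε)) ∧
      ∀ ε, l ^ n ≤ ε → ∀ z ∈ G, 0 < intervalMass s G (z - ε) (z + ε) := by
    induction n with
    | zero =>
      refine ⟨fun ε hε z hz => ?_, fun ε hε z hz => ?_⟩ <;> rw [pow_zero] at hε
      · rw [hUmass.eq_total _ _ (by linarith [(hF01 hz).2]) (by linarith [(hF01 hz).1])]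
        exact hu0
      · rw [hVmass.eq_total _ _ (by linarith [(hG01 hz).2]) (by linarith [(hG01 hz).1])]
        exact hv0
    | succ n ih =>
      rw [← hstep]
      exact ⟨fun ε hε z hz => intervalMass_pos_step ha hb hF hFrec hal hbl (by positivity)
          ih.1 ih.2 hε hz,
        fun ε hε z hz => intervalMass_pos_step hc hd hG hGrec hcl hdl (by positivity)
          ih.2 ih.1 hε hz⟩
  obtain ⟨n, hn⟩ := exists_pow_lt_of_lt_one hε hl1
  exact (key n).1 ε hn.le z hz

/-- `p < q` are the endpoints of a bounded complementary interval of `F`. -/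
structure IsGap (F : Set ℝ) (p q : ℝ) : Prop where
  left_mem : p ∈ F
  right_mem : q ∈ F
  lt : p < q
  notMem : ∀ x ∈ F, p < x → ¬ x < q

section Gaps

variable {a b k : ℝ} {F F₁ F₂ : Set ℝ}

theorem isGap_middle (ha : 0 < a) (hb : 0 < b) (hak : a < k)
    (hsub₁ : F₁ ⊆ Set.Icc 0 1) (hsub₂ : F₂ ⊆ Set.Icc 0 1) (h1 : (1 : ℝ) ∈ F₁) (h0 : (0 : ℝ) ∈ F₂)
    (hF : F = (fun x => a * x) '' F₁ ∪ (fun x => b * x + k) '' F₂) : IsGap F a k where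
  left_mem := by rw [hF]; exact Or.inl ⟨1, h1, by simp⟩
  right_mem := by rw [hF]; exact Or.inr ⟨0, h0, by simp⟩
  lt := hak
  notMem x hx hax hxk := by
    rw [hF] at hx
    rcases hx with ⟨w, hw, rfl⟩ | ⟨w, hw, rfl⟩
    · have := mul_le_mul_of_nonneg_left (hsub₁ hw).2 ha.le
      dsimp only at hax
      linarith
    · have := mul_nonneg hb.le (hsub₂ hw).1
      dsimp only at hxk
      linarith

theorem IsGap.image_left {p q : ℝ} (ha : 0 < a) (hb : 0 < b) (hak : a < k)
    (hsub₁ : F₁ ⊆ Set.Icc 0 1) (hsub₂ : F₂ ⊆ Set.Icc 0 1)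
    (hF : F = (fun x => a * x) '' F₁ ∪ (fun x => b * x + k) '' F₂) (hgap : IsGap F₁ p q) :
    IsGap F (a * p) (a * q) where
  left_mem := by rw [hF]; exact Or.inl ⟨p, hgap.left_mem, rfl⟩
  right_mem := by rw [hF]; exact Or.inl ⟨q, hgap.right_mem, rfl⟩
  lt := mul_lt_mul_of_pos_left hgap.lt ha
  notMem x hx hpx hxq := by
    rw [hF] at hx
    rcases hx with ⟨w, hw, rfl⟩ | ⟨w, hw, rfl⟩
    · exact hgap.notMem w hw (lt_of_mul_lt_mul_left hpx ha.le) (lt_of_mul_lt_mul_left hxq ha.le)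
    · have h1 := mul_nonneg hb.le (hsub₂ hw).1
      have h2 := mul_le_mul_of_nonneg_left (hsub₁ hgap.right_mem).2 ha.le
      dsimp only at hxq
      linarith

theorem IsGap.image_right {p q : ℝ} (ha : 0 < a) (hb : 0 < b) (hak : a < k)
    (hsub₁ : F₁ ⊆ Set.Icc 0 1) (hsub₂ : F₂ ⊆ Set.Icc 0 1)
    (hF : F = (fun x => a * x) '' F₁ ∪ (fun x => b * x + k) '' F₂) (hgap : IsGap F₂ p q) :
    IsGap F (b * p + k) (b * q + k) where
  left_mem := by rw [hF]; exact Or.inr ⟨p, hgap.left_mem, rfl⟩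
  right_mem := by rw [hF]; exact Or.inr ⟨q, hgap.right_mem, rfl⟩
  lt := by linarith [mul_lt_mul_of_pos_left hgap.lt hb]
  notMem x hx hpx hxq := by
    rw [hF] at hx
    rcases hx with ⟨w, hw, rfl⟩ | ⟨w, hw, rfl⟩
    · have h1 := mul_nonneg hb.le (hsub₂ hgap.left_mem).1
      have h2 := mul_le_mul_of_nonneg_left (hsub₁ hw).2 ha.le
      dsimp only at hpx
      linarith
    · exact hgap.notMem w hw (lt_of_mul_lt_mul_left (by linarith) hb.le)
        (lt_of_mul_lt_mul_left (by linarith) hb.le)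

theorem IsGap.cases {p q : ℝ} (ha : 0 < a) (hb : 0 < b) (hak : a < k)
    (hsub₁ : F₁ ⊆ Set.Icc 0 1) (hsub₂ : F₂ ⊆ Set.Icc 0 1) (h1 : (1 : ℝ) ∈ F₁) (h0 : (0 : ℝ) ∈ F₂)
    (hF : F = (fun x => a * x) '' F₁ ∪ (fun x => b * x + k) '' F₂) (hgap : IsGap F p q) :
    q - p = k - a ∨ (∃ p' q', IsGap F₁ p' q' ∧ q - p = a * (q' - p')) ∨
      ∃ p' q', IsGap F₂ p' q' ∧ q - p = b * (q' - p') := by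
  have hmid := isGap_middle ha hb hak hsub₁ hsub₂ h1 h0 hF
  have hp := hgap.left_mem
  have hq := hgap.right_mem
  have hlt := hgap.lt
  have hleft (x : ℝ) (hx : x ∈ F₁) : a * x ∈ F := by rw [hF]; exact Or.inl ⟨x, hx, rfl⟩
  have hright (x : ℝ) (hx : x ∈ F₂) : b * x + k ∈ F := by rw [hF]; exact Or.inr ⟨x, hx, rfl⟩
  rw [hF] at hp hq
  rcases hp with ⟨w, hw, rfl⟩ | ⟨w, hw, rfl⟩ <;> rcases hq with ⟨v, hv, rfl⟩ | ⟨v, hv, rfl⟩ <;>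
    dsimp only at hgap hlt ⊢
  · refine Or.inr (Or.inl ⟨w, v, ⟨hw, hv, lt_of_mul_lt_mul_left hlt ha.le, fun x hx hwx hxv => ?_⟩,
      by ring⟩)
    exact hgap.notMem _ (hleft x hx) (mul_lt_mul_of_pos_left hwx ha)
      (mul_lt_mul_of_pos_left hxv ha)
  · left
    have hw1 := mul_le_mul_of_nonneg_left (hsub₁ hw).2 ha.le
    have hv0 := mul_nonneg hb.le (hsub₂ hv).1
    have hwa : ¬ a * w < a := fun h => hgap.notMem a hmid.left_mem h (by linarith)
    have hvk : ¬ k < b * v + k := fun h => hgap.notMem k hmid.right_mem (by linarith) h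
    linarith
  · have hv1 := mul_le_mul_of_nonneg_left (hsub₁ hv).2 ha.le
    have hw0 := mul_nonneg hb.le (hsub₂ hw).1
    linarith
  · refine Or.inr (Or.inr ⟨w, v, ⟨hw, hv, lt_of_mul_lt_mul_left (by linarith) hb.le,
      fun x hx hwx hxv => ?_⟩, by ring⟩)
    exact hgap.notMem _ (hright x hx) (by linarith [mul_lt_mul_of_pos_left hwx hb])
      (by linarith [mul_lt_mul_of_pos_left hxv hb])

theorem IsGap.image_affine {r t p q : ℝ} (hr : r ≠ 0) (hsub : ∀ x ∈ F, r * x + t ∈ F)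
    (hF01 : F ⊆ Set.Icc 0 1)
    (hfill : ∀ z ∈ F, z ∈ Set.uIcc t (r + t) → ∃ x ∈ F, r * x + t = z)
    (hgap : IsGap F p q) : ∃ p' q', IsGap F p' q' ∧ q' - p' = |r| * (q - p) := by
  have hp := hF01 hgap.left_mem
  have hq := hF01 hgap.right_mem
  have hlt := hgap.lt
  rcases lt_or_gt_of_ne hr with hr | hr
  · refine ⟨r * q + t, r * p + t, ⟨hsub q hgap.right_mem, hsub p hgap.left_mem, by nlinarith,
      fun x hx h1 h2 => ?_⟩, by rw [abs_of_neg hr]; ring⟩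
    obtain ⟨z, hz, rfl⟩ := hfill x hx (by
      rw [Set.uIcc_of_ge (by linarith)]
      constructor <;> nlinarith [hp.1, hp.2, hq.1, hq.2])
    exact hgap.notMem z hz (by nlinarith) (by nlinarith)
  · refine ⟨r * p + t, r * q + t, ⟨hsub p hgap.left_mem, hsub q hgap.right_mem, by nlinarith,
      fun x hx h1 h2 => ?_⟩, by rw [abs_of_pos hr]; ring⟩
    obtain ⟨z, hz, rfl⟩ := hfill x hx (by
      rw [Set.uIcc_of_le (by linarith)]
      constructor <;> nlinarith [hp.1, hp.2, hq.1, hq.2])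
    exact hgap.notMem z hz (by nlinarith) (by nlinarith)

theorem IsGap.preimage_affine {r t p q : ℝ} (hr : r ≠ 0) (hsub : ∀ x ∈ F, r * x + t ∈ F)
    (hfill : ∀ z ∈ F, z ∈ Set.uIcc t (r + t) → ∃ x ∈ F, r * x + t = z)
    (hgap : IsGap F p q) (hpI : p ∈ Set.uIcc t (r + t)) (hqI : q ∈ Set.uIcc t (r + t)) :
    ∃ p' q', IsGap F p' q' ∧ q - p = |r| * (q' - p') := by
  obtain ⟨w, hw, rfl⟩ := hfill p hgap.left_mem hpI
  obtain ⟨v, hv, rfl⟩ := hfill q hgap.right_mem hqI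
  have hlt := hgap.lt
  rcases lt_or_gt_of_ne hr with hr | hr
  · refine ⟨v, w, ⟨hv, hw, by nlinarith, fun x hx h1 h2 => ?_⟩, by rw [abs_of_neg hr]; ring⟩
    exact hgap.notMem _ (hsub x hx) (by nlinarith) (by nlinarith)
  · refine ⟨w, v, ⟨hw, hv, by nlinarith, fun x hx h1 h2 => ?_⟩, by rw [abs_of_pos hr]; ring⟩
    exact hgap.notMem _ (hsub x hx) (by nlinarith) (by nlinarith)

end Gaps

theorem exists_affine_of_abs_sub_eq {T : ℝ → ℝ} {r : ℝ}
    (hT : ∀ x y, |T x - T y| = r * |x - y|) : ∃ σ t, |σ| = r ∧ ∀ x, T x = σ * x + t := by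
  have hσ : |T 1 - T 0| = r := by simpa using hT 1 0
  refine ⟨T 1 - T 0, T 0, hσ, fun x => ?_⟩
  have e1 := congrArg (· ^ 2) (hT x 0)
  have e2 := congrArg (· ^ 2) (hT x 1)
  have e3 := congrArg (· ^ 2) hσ
  simp only [mul_pow, sq_abs] at e1 e2 e3
  rcases eq_or_ne (T 1 - T 0) 0 with h | h
  · have : r = 0 := by simpa [h] using hσ.symm
    have h2 : (T x - T 0) ^ 2 = 0 := by rw [e1, this]; ring
    rw [h]
    linarith [pow_eq_zero_iff (two_ne_zero) |>.1 h2]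
  · have : (T 1 - T 0) * (T x - T 0) = (T 1 - T 0) * ((T 1 - T 0) * x) := by
      linear_combination (e1 - e2 + (1 - 2 * x) * e3) / 2
    linarith [mul_left_cancel₀ h this]

theorem monomial_exponents_eq {gu gv a b c d : ℝ} (hgu : gu ≠ 0) (hgv : gv ≠ 0) (ha : a ≠ 0)
    (hb : b ≠ 0) (hc : c ≠ 0) (hd : d ≠ 0)
    (hind : ∀ m1 m2 m3 m4 m5 m6 : ℤ,
      gu ^ m1 * gv ^ m2 * a ^ m3 * b ^ m4 * c ^ m5 * d ^ m6 = 1 →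
      m1 = 0 ∧ m2 = 0 ∧ m3 = 0 ∧ m4 = 0 ∧ m5 = 0 ∧ m6 = 0)
    (n₁ n₂ n₃ n₄ n₅ n₆ m₁ m₂ m₃ m₄ m₅ m₆ : ℕ)
    (h : gu ^ n₁ * gv ^ n₂ * a ^ n₃ * b ^ n₄ * c ^ n₅ * d ^ n₆ =
      gu ^ m₁ * gv ^ m₂ * a ^ m₃ * b ^ m₄ * c ^ m₅ * d ^ m₆) :
    n₁ = m₁ ∧ n₂ = m₂ ∧ n₃ = m₃ ∧ n₄ = m₄ ∧ n₅ = m₅ ∧ n₆ = m₆ := by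
  have := hind (n₁ - m₁) (n₂ - m₂) (n₃ - m₃) (n₄ - m₄) (n₅ - m₅) (n₆ - m₆) (by
    simp only [zpow_sub₀ hgu, zpow_sub₀ hgv, zpow_sub₀ ha, zpow_sub₀ hb, zpow_sub₀ hc,
      zpow_sub₀ hd, zpow_natCast]
    field_simp
    linear_combination h)
  omega

/-- Every gap length of the attractor at `u` is `gu` or `gv` times the ratio of a directed path
starting at `u`. -/
theorem gap_length_eq_monomial {a gu b c gv d : ℝ} {Fu Fv : Set ℝ}
    (ha : 0 < a) (hgu : 0 < gu) (hb : 0 < b) (hc : 0 < c) (hgv : 0 < gv) (hd : 0 < d)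
    (hsum1 : a + gu + b = 1) (hsum2 : c + gv + d = 1)
    (hFu0 : (0 : ℝ) ∈ Fu) (hFu1 : (1 : ℝ) ∈ Fu) (hFusub : Fu ⊆ Set.Icc 0 1)
    (hFv0 : (0 : ℝ) ∈ Fv) (hFv1 : (1 : ℝ) ∈ Fv) (hFvsub : Fv ⊆ Set.Icc 0 1)
    (hFu : Fu = (fun x => a * x) '' Fu ∪ (fun x => b * x + (a + gu)) '' Fv)
    (hFv : Fv = (fun x => c * x) '' Fv ∪ (fun x => d * x + (c + gv)) '' Fu)
    {p q : ℝ} (hgap : IsGap Fu p q) :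
    (∃ i j k : ℕ, (k = 0 → j = 0) ∧ q - p = gu * (a ^ i * b ^ k * c ^ j * d ^ k)) ∨
      ∃ i j k : ℕ, q - p = gv * (a ^ i * b ^ (k + 1) * c ^ j * d ^ k) := by
  obtain ⟨l, hl0, hl1, hal, hbl, hcl, hdl⟩ : ∃ l : ℝ, 0 < l ∧ l < 1 ∧ a ≤ l ∧ b ≤ l ∧
      c ≤ l ∧ d ≤ l := by
    refine ⟨max (max a b) (max c d), by positivity, ?_, by simp, by simp, by simp, by simp⟩
    refine max_lt (max_lt ?_ ?_) (max_lt ?_ ?_) <;> linarith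
  have hshrink {r x : ℝ} {n : ℕ} (hr : r ≤ l) (hx : 0 < x) (h : l ^ (n + 1) < r * x) :
      l ^ n < x := by
    have h1 := mul_le_mul_of_nonneg_right hr hx.le
    rw [pow_succ'] at h
    exact lt_of_mul_lt_mul_left (h.trans_le h1) hl0.le
  have key (n : ℕ) : (∀ p q, IsGap Fu p q → l ^ n < q - p →
      (∃ i j k : ℕ, (k = 0 → j = 0) ∧ q - p = gu * (a ^ i * b ^ k * c ^ j * d ^ k)) ∨
        ∃ i j k : ℕ, q - p = gv * (a ^ i * b ^ (k + 1) * c ^ j * d ^ k)) ∧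
      ∀ p q, IsGap Fv p q → l ^ n < q - p →
      (∃ i j k : ℕ, q - p = gu * (a ^ i * b ^ k * c ^ j * d ^ (k + 1))) ∨
        ∃ i j k : ℕ, (k = 0 → i = 0) ∧ q - p = gv * (a ^ i * b ^ k * c ^ j * d ^ k) := by
    induction n with
    | zero =>
      refine ⟨fun p q h hl => ?_, fun p q h hl => ?_⟩ <;> exfalso <;> rw [pow_zero] at hl
      · linarith [(hFusub h.left_mem).1, (hFusub h.right_mem).2]
      · linarith [(hFvsub h.left_mem).1, (hFvsub h.right_mem).2]
    | succ n ih =>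
      refine ⟨fun p q h hl => ?_, fun p q h hl => ?_⟩
      · rcases h.cases ha hb (by linarith) hFusub hFvsub hFu1 hFv0 hFu with
          h | ⟨p', q', h, e⟩ | ⟨p', q', h, e⟩
        · exact Or.inl ⟨0, 0, 0, by simp, by simp [h]⟩
        · rw [e] at hl ⊢
          rcases ih.1 p' q' h (hshrink hal (sub_pos.2 h.lt) hl) with
            ⟨i, j, k, hk, e'⟩ | ⟨i, j, k, e'⟩ <;> rw [e']
          · exact Or.inl ⟨i + 1, j, k, hk, by ring⟩
          · exact Or.inr ⟨i + 1, j, k, by ring⟩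
        · rw [e] at hl ⊢
          rcases ih.2 p' q' h (hshrink hbl (sub_pos.2 h.lt) hl) with
            ⟨i, j, k, e'⟩ | ⟨i, j, k, -, e'⟩ <;> rw [e']
          · exact Or.inl ⟨i, j, k + 1, by simp, by ring⟩
          · exact Or.inr ⟨i, j, k, by ring⟩
      · rcases h.cases hc hd (by linarith) hFvsub hFusub hFv1 hFu0 hFv with
          h | ⟨p', q', h, e⟩ | ⟨p', q', h, e⟩
        · exact Or.inr ⟨0, 0, 0, by simp, by simp [h]⟩
        · rw [e] at hl ⊢
          rcases ih.2 p' q' h (hshrink hcl (sub_pos.2 h.lt) hl) with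
            ⟨i, j, k, e'⟩ | ⟨i, j, k, hk, e'⟩ <;> rw [e']
          · exact Or.inl ⟨i, j + 1, k, by ring⟩
          · exact Or.inr ⟨i, j + 1, k, hk, by ring⟩
        · rw [e] at hl ⊢
          rcases ih.1 p' q' h (hshrink hdl (sub_pos.2 h.lt) hl) with
            ⟨i, j, k, -, e'⟩ | ⟨i, j, k, e'⟩ <;> rw [e']
          · exact Or.inl ⟨i, j, k, by ring⟩
          · exact Or.inr ⟨i, j, k + 1, by simp, by ring⟩
  obtain ⟨n, hn⟩ := exists_pow_lt_of_lt_one (sub_pos.2 hgap.lt) hl1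
  exact (key n).1 p q hgap hn

theorem stmt18
    (a gu b c gv d : ℝ)
    (ha : 0 < a) (hgu : 0 < gu) (hb : 0 < b) (hc : 0 < c) (hgv : 0 < gv) (hd : 0 < d)
    (hsum1 : a + gu + b = 1) (hsum2 : c + gv + d = 1)
    (Fu Fv : Set ℝ)
    (hFuc : IsCompact Fu) (hFvc : IsCompact Fv)
    (hFu0 : (0 : ℝ) ∈ Fu) (hFu1 : (1 : ℝ) ∈ Fu) (hFusub : Fu ⊆ Set.Icc 0 1)
    (hFv0 : (0 : ℝ) ∈ Fv) (hFv1 : (1 : ℝ) ∈ Fv) (hFvsub : Fv ⊆ Set.Icc 0 1)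
    (hFu : Fu = (fun x => a * x) '' Fu ∪ (fun x => b * x + (a + gu)) '' Fv)
    (hFv : Fv = (fun x => c * x) '' Fv ∪ (fun x => d * x + (c + gv)) '' Fu)
    (s : ℝ) (hs0 : 0 < s) (hs1 : s < 1)
    (hdim : (1 - a ^ s) * (1 - c ^ s) = b ^ s * d ^ s)
    (hu hv : ℝ) (hhu0 : 0 < hu) (hhv0 : 0 < hv)
    (hhuH : μH[s] Fu = ENNReal.ofReal hu) (hhvH : μH[s] Fv = ENNReal.ofReal hv)
    (heigu : hu = a ^ s * hu + b ^ s * hv)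
    (heigv : hv = d ^ s * hu + c ^ s * hv)
    (hcond2 : hv ≤ hu)
    (hcond3 : b * a ^ s ≤ (a + gu) * (1 - a ^ s))
    (hind : ∀ m1 m2 m3 m4 m5 m6 : ℤ,
      gu ^ m1 * gv ^ m2 * a ^ m3 * b ^ m4 * c ^ m5 * d ^ m6 = 1 →
      m1 = 0 ∧ m2 = 0 ∧ m3 = 0 ∧ m4 = 0 ∧ m5 = 0 ∧ m6 = 0)
    :
    ¬ ∃ (n : ℕ) (T : Fin n → ℝ → ℝ) (rT : Fin n → ℝ),
      2 ≤ n ∧ (∀ i, 0 < rT i ∧ rT i < 1) ∧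
      (∀ i x y, |T i x - T i y| = rT i * |x - y|) ∧
      Fu = ⋃ i, T i '' Fu := by
  rintro ⟨n, T, rT, -, hrT, hT, hUnion⟩
  have hba : b ≤ 1 - a ^ s := by
    have : a + gu = 1 - b := by linarith
    rw [this] at hcond3
    linarith
  have hUmass := isIntervalMass_intervalMass hhuH hhu0.le hFusub
  have hVmass := isIntervalMass_intervalMass hhvH hhv0.le hFvsub
  have hUrec := intervalMass_rec hs0.le ha hb (by linarith) hFvc hFusub hFvsub hhuH hhvH hFu
  have hVrec := intervalMass_rec hs0.le hc hd (by linarith) hFuc hFvsub hFusub hhvH hhuH hFv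
  have hle (x y : ℝ) (hxy : x ≤ y) : intervalMass s Fu x y ≤ hu * (y - x) ^ s :=
    interval_mass_le hs0 hs1 ha hgu hb hc hgv hd hsum1 hsum2 hhv0 hcond2 heigu heigv hba
      hUmass hVmass hUrec hVrec hxy
  have hpos := intervalMass_pos ha hb hc hd (by linarith) (by linarith) (by linarith)
    (by linarith) hFusub hFvsub hhu0 hhv0 hFu hFv hUmass hVmass hUrec hVrec
  have hmid := isGap_middle ha hb (by linarith) hFusub hFvsub hFu1 hFv0 hFu
  have hmidv := isGap_middle hc hd (by linarith) hFvsub hFusub hFv1 hFu0 hFv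
  have hgapv (m : ℕ) : IsGap Fu (b * (c ^ m * c) + (a + gu)) (b * (c ^ m * (c + gv)) + (a + gu)) := by
    have : IsGap Fv (c ^ m * c) (c ^ m * (c + gv)) := by
      induction m with
      | zero => simpa using hmidv
      | succ m ih =>
        have := ih.image_left hc hd (by linarith) hFvsub hFusub hFv
        rwa [← mul_assoc, ← mul_assoc c, ← pow_succ'] at this
    exact this.image_right ha hb (by linarith) hFusub hFvsub hFu
  have hform {p q : ℝ} (h : IsGap Fu p q) := gap_length_eq_monomial ha hgu hb hc hgv hd hsum1
    hsum2 hFu0 hFu1 hFusub hFv0 hFv1 hFvsub hFu hFv h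
  have hexp := monomial_exponents_eq hgu.ne' hgv.ne' ha.ne' hb.ne' hc.ne' hd.ne' hind
  obtain ⟨i, x₀, hx₀, hTx₀⟩ := Set.mem_iUnion.1 (hUnion ▸ hmid.right_mem : a + gu ∈ ⋃ i, T i '' Fu)
  obtain ⟨σ, t, hσ, hTσ⟩ := exists_affine_of_abs_sub_eq (hT i)
  obtain ⟨hr0, hr1⟩ := hrT i
  rw [hTσ] at hTx₀
  set r := rT i with hr
  have hσ0 : σ ≠ 0 := abs_pos.1 (hσ ▸ hr0)
  have hsub (x : ℝ) (hx : x ∈ Fu) : σ * x + t ∈ Fu := by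
    rw [hUnion]
    exact Set.mem_iUnion.2 ⟨i, x, hx, hTσ x⟩
  have hfill (z : ℝ) (hz : z ∈ Fu) (hzI : z ∈ Set.uIcc t (σ + t)) : ∃ x ∈ Fu, σ * x + t = z :=
    mem_image_affine_of_mem_uIcc hs0.le hFuc hFu0 hFu1 hhu0.le hhuH hle hpos hσ0 hsub hFusub hz hzI
  have hscale {p q : ℝ} (h : IsGap Fu p q) : ∃ p' q', IsGap Fu p' q' ∧ q' - p' = r * (q - p) :=
    hσ ▸ h.image_affine hσ0 hsub hFusub hfill
  have hunscale {p q : ℝ} (h : IsGap Fu p q) (hp : p ∈ Set.uIcc t (σ + t))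
      (hq : q ∈ Set.uIcc t (σ + t)) : ∃ p' q', IsGap Fu p' q' ∧ q - p = r * (q' - p') :=
    hσ ▸ h.preimage_affine hσ0 hsub hfill hp hq
  obtain ⟨i, j, k, hkj, hrw⟩ : ∃ i j k : ℕ, (k = 0 → j = 0) ∧ r = a ^ i * b ^ k * c ^ j * d ^ k := by
    obtain ⟨p, q, hpq, e⟩ := hscale hmid
    rcases hform hpq with ⟨i, j, k, hk, e'⟩ | ⟨i, j, k, e'⟩
    · refine ⟨i, j, k, hk, mul_left_cancel₀ hgu.ne' ?_⟩
      linear_combination e' - e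
    · obtain ⟨p₂, q₂, hpq₂, e₂⟩ := hscale (hgapv 0)
      rcases hform hpq₂ with ⟨i₂, j₂, k₂, -, e₂'⟩ | ⟨i₂, j₂, k₂, e₂'⟩
      · have := hexp 0 2 i (k + 2) j k 2 0 i₂ k₂ j₂ k₂ (by
          linear_combination gv * b * (e - e') - gu * (e₂ - e₂'))
        omega
      · have := hexp 0 2 i (k + 2) j k 1 1 i₂ (k₂ + 1) j₂ k₂ (by
          linear_combination gv * b * (e - e') - gu * (e₂ - e₂'))
        omega
  have hk0 (hi : i = 0) (hk : k = 0) : False := by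
    rw [hrw, hkj hk, hi, hk] at hr1
    simp at hr1
  have hx₀I := hFusub hx₀
  have hkI : a + gu ∈ Set.uIcc t (σ + t) := by
    rw [← hTx₀, Set.mem_uIcc]
    rcases le_total 0 σ with h | h
    · left; constructor <;> nlinarith [hx₀I.1, hx₀I.2]
    · right; constructor <;> nlinarith [hx₀I.1, hx₀I.2]
  have haI : a ∉ Set.uIcc t (σ + t) := fun haI => by
    obtain ⟨p, q, hpq, e⟩ := hunscale hmid haI hkI
    rcases hform hpq with ⟨i', j', k', -, e'⟩ | ⟨i', j', k', e'⟩
    · have := hexp 1 0 0 0 0 0 1 0 (i + i') (k + k') (j + j') (k + k') (by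
        linear_combination e + r * e' + gu * (a ^ i' * b ^ k' * c ^ j' * d ^ k') * hrw)
      exact hk0 (by omega) (by omega)
    · have := hexp 1 0 0 0 0 0 0 1 (i + i') (k + k' + 1) (j + j') (k + k') (by
        linear_combination e + r * e' + gv * (a ^ i' * b ^ (k' + 1) * c ^ j' * d ^ k') * hrw)
      omega
  have htmem : t ∈ Fu := by simpa using hsub 0 hFu0
  have htmem' : σ + t ∈ Fu := by simpa using hsub 1 hFu1
  have hendpoints : min t (σ + t) ∈ Fu ∧ max t (σ + t) ∈ Fu := by
    rcases le_total t (σ + t) with h | h <;> simp [h, htmem, htmem']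
  have hmax : max t (σ + t) = min t (σ + t) + r := by
    have := max_sub_min_eq_abs t (σ + t)
    rw [add_sub_cancel_right, hσ] at this
    linarith
  have hmin : min t (σ + t) = a + gu := by
    refine le_antisymm hkI.1 (not_lt.1 fun h => ?_)
    refine hmid.notMem _ hendpoints.1 (not_le.1 fun h' => haI ⟨h', ?_⟩) h
    linarith [hkI.2]
  have hrb : r / b ≤ 1 := by
    rw [div_le_one hb]
    linarith [(hFusub hendpoints.2).2]
  obtain ⟨m, hm1, hm2⟩ := exists_nat_pow_near_of_lt_one (div_pos hr0 hb) hrb hc (by linarith)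
  rw [lt_div_iff₀ hb, pow_succ] at hm1
  have hqle : b * (c ^ m * (c + gv)) + (a + gu) ≤ max t (σ + t) :=
    not_lt.1 <| (hgapv m).notMem _ hendpoints.2 (by linarith)
  have hgap := hgapv m
  obtain ⟨p, q, hpq, e⟩ := hunscale hgap
    ⟨by change min t (σ + t) ≤ _; rw [hmin]; have : 0 < b * (c ^ m * c) := by positivity
        linarith, hgap.lt.le.trans hqle⟩
    ⟨by change min t (σ + t) ≤ _; rw [hmin]; have : 0 < b * (c ^ m * (c + gv)) := by positivity
        linarith, hqle⟩
  rcases hform hpq with ⟨i', j', k', -, e'⟩ | ⟨i', j', k', e'⟩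
  · have := hexp 0 1 0 1 m 0 1 0 (i + i') (k + k') (j + j') (k + k') (by
      linear_combination e + r * e' + gu * (a ^ i' * b ^ k' * c ^ j' * d ^ k') * hrw)
    omega
  · have := hexp 0 1 0 1 m 0 0 1 (i + i') (k + k' + 1) (j + j') (k + k') (by
      linear_combination e + r * e' + gv * (a ^ i' * b ^ (k' + 1) * c ^ j' * d ^ k') * hrw)
    exact hk0 (by omega) (by omega)
end

section
/- For the 2-vertex IFS on the unit interval with b = d, suppose h_v ≤ h_u and (a + g_u)(1 − a^s) ≥ b·a^s (so that H^s(F_u) = 1), and suppose g_u, g_v, a, b, c are multiplicatively rationally independent. Then the attractor F_u is not the attractor of any standard (1-vertex) IFS on ℝ, with or without separation conditions: there do not exist n ≥ 2 and contracting similarities T₁, …, T_n : ℝ → ℝ such that F_u = ⋃_{i=1}^{n} T_i(F_u). -/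
open MeasureTheory
open scoped ENNReal NNReal

/-- A monotone family of properties of an error term that holds for the error `1` and is
improved by a factor `ρ < 1` holds for every positive error. -/
lemma forall_pos_of_contracting {P : ℝ → Prop} {ρ : ℝ} (hρ0 : 0 ≤ ρ) (hρ1 : ρ < 1)
    (hmono : ∀ ε δ, ε ≤ δ → P ε → P δ) (hone : P 1)
    (hstep : ∀ ε, 0 ≤ ε → P ε → P (ρ * ε)) (ε : ℝ) (hε : 0 < ε) : P ε := by
  have hpow : ∀ n : ℕ, P (ρ ^ n) := by
    intro n
    induction n with
    | zero => simpa using hone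
    | succ k ih => rw [pow_succ']; exact hstep _ (pow_nonneg hρ0 k) ih
  obtain ⟨n, hn⟩ := exists_pow_lt_of_lt_one hε hρ1
  exact hmono _ _ hn.le (hpow n)

lemma rpow_concave_one {s w y : ℝ} (hs0 : 0 < s) (hs1 : s < 1) (hw0 : 0 ≤ w) (hw1 : w ≤ 1)
    (hy : 0 ≤ y) : (1 - w) + w * y ^ s ≤ ((1 - w) + w * y) ^ s := by
  have h := (Real.concaveOn_rpow hs0.le hs1.le).2 (Set.mem_Ici.2 zero_le_one) (Set.mem_Ici.2 hy)
    (sub_nonneg.2 hw1) hw0 (by ring)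
  simpa using h

lemma rpow_strictConcave_one {s w y : ℝ} (hs0 : 0 < s) (hs1 : s < 1) (hw0 : 0 < w) (hw1 : w < 1)
    (hy : 0 ≤ y) (hy1 : y ≠ 1) : (1 - w) + w * y ^ s < ((1 - w) + w * y) ^ s := by
  have h := (Real.strictConcaveOn_rpow hs0 hs1).2 (Set.mem_Ici.2 zero_le_one) (Set.mem_Ici.2 hy)
    hy1.symm (sub_pos.2 hw1) hw0 (by ring)
  simpa using h

lemma mul_rpow_div {s x t : ℝ} (hx : 0 < x) (ht : 0 ≤ t) : x ^ s * (t / x) ^ s = t ^ s := by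
  rw [← Real.mul_rpow hx.le (by positivity), mul_div_cancel₀ t hx.ne']

/-- Bounds for the mass of initial intervals of the two attractors. -/
lemma initial_mass_le {a b c s h : ℝ} {L M : ℝ → ℝ}
    (ha : 0 < a) (hb : 0 < b) (hc : 0 < c) (hab : a < 1 - b) (hcb : c < 1 - b)
    (hs0 : 0 < s) (hs1 : s < 1) (hh0 : 0 < h) (hh1 : h ≤ 1)
    (heu : 1 = a ^ s + b ^ s * h) (hev : h = b ^ s + c ^ s * h) (hbk : b ≤ b ^ s * h)
    (hL1 : ∀ t, L t ≤ 1) (hM1 : ∀ t, M t ≤ h) (hL0 : ∀ t ≤ 0, L t ≤ 0) (hM0 : ∀ t ≤ 0, M t ≤ 0)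
    (hL : ∀ t, L t ≤ a ^ s * L (t / a) + b ^ s * M ((t - (1 - b)) / b))
    (hM : ∀ t, M t ≤ c ^ s * M (t / c) + b ^ s * L ((t - (1 - b)) / b)) :
    ∀ t, 0 ≤ t → t ≤ 1 → L t ≤ t ^ s ∧ M t ≤ h * t ^ s := by
  have has : a ^ s < 1 := Real.rpow_lt_one ha.le (by linarith) hs0
  have hbs : b ^ s < 1 := Real.rpow_lt_one hb.le (by linarith) hs0
  have hcs : c ^ s < 1 := Real.rpow_lt_one hc.le (by linarith) hs0
  have has0 : 0 < a ^ s := Real.rpow_pos_of_pos ha s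
  have hbs0 : 0 < b ^ s := Real.rpow_pos_of_pos hb s
  have hcs0 : 0 < c ^ s := Real.rpow_pos_of_pos hc s
  have key : ∀ ε, 0 < ε → ∀ t, 0 ≤ t → t ≤ 1 → L t ≤ t ^ s + ε ∧ M t ≤ h * t ^ s + ε := by
    refine forall_pos_of_contracting (ρ := max (a ^ s) (max (b ^ s) (c ^ s))) (by positivity)
      (by simp [has, hbs, hcs]) ?_ ?_ ?_
    · intro ε δ hεδ hP t h0 h1
      have := hP t h0 h1
      exact ⟨by linarith, by linarith⟩
    · intro t h0 _
      have : 0 ≤ t ^ s := Real.rpow_nonneg h0 s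
      have : 0 ≤ h * t ^ s := by positivity
      exact ⟨by linarith [hL1 t], by linarith [hM1 t]⟩
    · intro ε hε hP t h0 h1
      set ρ := max (a ^ s) (max (b ^ s) (c ^ s))
      have hρa : a ^ s * ε ≤ ρ * ε := mul_le_mul_of_nonneg_right (le_max_left _ _) hε
      have hρb : b ^ s * ε ≤ ρ * ε :=
        mul_le_mul_of_nonneg_right ((le_max_left _ _).trans (le_max_right _ _)) hε
      have hρc : c ^ s * ε ≤ ρ * ε :=
        mul_le_mul_of_nonneg_right ((le_max_right _ _).trans (le_max_right _ _)) hε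
      have hρ : 0 ≤ ρ * ε := le_trans (by positivity) hρa
      have hLt := hL t
      have hMt := hM t
      rcases le_or_gt t (1 - b) with htb | htb
      · have hneg : (t - (1 - b)) / b ≤ 0 := div_nonpos_of_nonpos_of_nonneg (by linarith) hb.le
        have hz1 := mul_nonpos_of_nonneg_of_nonpos hbs0.le (hL0 _ hneg)
        have hz2 := mul_nonpos_of_nonneg_of_nonpos hbs0.le (hM0 _ hneg)
        constructor
        · rcases le_or_gt t a with hta | hta
          · have h2 := mul_le_mul_of_nonneg_left
              (hP (t / a) (by positivity) ((div_le_one ha).2 hta)).1 has0.le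
            rw [mul_add, mul_rpow_div ha h0] at h2
            linarith
          · have h2 := mul_le_mul_of_nonneg_left (hL1 (t / a)) has0.le
            have h3 : a ^ s ≤ t ^ s := Real.rpow_le_rpow ha.le hta.le hs0.le
            linarith
        · rcases le_or_gt t c with htc | htc
          · have h2 := mul_le_mul_of_nonneg_left
              (hP (t / c) (by positivity) ((div_le_one hc).2 htc)).2 hcs0.le
            rw [mul_add, mul_left_comm, mul_rpow_div hc h0] at h2
            linarith
          · have h2 := mul_le_mul_of_nonneg_left (hM1 (t / c)) hcs0.le
            have h3 : c ^ s ≤ t ^ s := Real.rpow_le_rpow hc.le htc.le hs0.le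
            nlinarith
      · set τ := (t - (1 - b)) / b with hτ
        have hτ0 : 0 ≤ τ := div_nonneg (by linarith) hb.le
        have hτ1 : τ ≤ 1 := (div_le_one hb).2 (by linarith)
        have htτ : t = (1 - b) + b * τ := by rw [hτ]; field_simp; ring
        have hconc := rpow_concave_one hs0 hs1 hb.le (by linarith) hτ0
        rw [← htτ] at hconc
        have hτs : 0 ≤ 1 - τ ^ s := sub_nonneg.2 (Real.rpow_le_one hτ0 hτ1 hs0.le)
        have hts : 0 ≤ 1 - t ^ s := sub_nonneg.2 (Real.rpow_le_one h0 h1 hs0.le)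
        obtain ⟨hP1, hP2⟩ := hP τ hτ0 hτ1
        have e1 := mul_le_mul_of_nonneg_left hP1 hbs0.le
        have e2 := mul_le_mul_of_nonneg_left hP2 hbs0.le
        have f1 := mul_le_mul_of_nonneg_left (hL1 (t / a)) has0.le
        have f2 := mul_le_mul_of_nonneg_left (hM1 (t / c)) hcs0.le
        have g1 := mul_le_mul_of_nonneg_right hbk hτs
        have g2 : b * (1 - τ ^ s) ≤ b ^ s * (1 - τ ^ s) :=
          mul_le_mul_of_nonneg_right (by nlinarith) hτs
        have g3 := mul_le_mul_of_nonneg_right hh1 hts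
        constructor
        · linarith
        · linarith
  intro t h0 h1
  exact ⟨le_of_forall_pos_le_add fun ε hε => (key ε hε t h0 h1).1,
    le_of_forall_pos_le_add fun ε hε => (key ε hε t h0 h1).2⟩

/-- Bounds for the mass of final intervals of the two attractors. -/
lemma final_mass_le {a b c s h : ℝ} {L M : ℝ → ℝ}
    (ha : 0 < a) (hb : 0 < b) (hc : 0 < c) (hab : a < 1 - b) (hcb : c < 1 - b)
    (hs0 : 0 < s) (hs1 : s < 1) (hh1 : h ≤ 1)
    (heu : 1 = a ^ s + b ^ s * h) (hev : h = b ^ s + c ^ s * h)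
    (hL1 : ∀ t, L t ≤ 1) (hM1 : ∀ t, M t ≤ h) (hL0 : ∀ t ≤ 0, L t ≤ 0) (hM0 : ∀ t ≤ 0, M t ≤ 0)
    (hL : ∀ t, L t ≤ a ^ s * L ((t - (1 - a)) / a) + b ^ s * M (t / b))
    (hM : ∀ t, M t ≤ c ^ s * M ((t - (1 - c)) / c) + b ^ s * L (t / b)) :
    ∀ t, 0 ≤ t → t ≤ 1 → L t ≤ t ^ s ∧ M t ≤ t ^ s := by
  have has : a ^ s < 1 := Real.rpow_lt_one ha.le (by linarith) hs0
  have hbs : b ^ s < 1 := Real.rpow_lt_one hb.le (by linarith) hs0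
  have hcs : c ^ s < 1 := Real.rpow_lt_one hc.le (by linarith) hs0
  have has0 : 0 < a ^ s := Real.rpow_pos_of_pos ha s
  have hbs0 : 0 < b ^ s := Real.rpow_pos_of_pos hb s
  have hcs0 : 0 < c ^ s := Real.rpow_pos_of_pos hc s
  have haas : a ≤ a ^ s := Real.self_le_rpow_of_le_one ha.le (by linarith) hs1.le
  have hccs : c ≤ c ^ s := Real.self_le_rpow_of_le_one hc.le (by linarith) hs1.le
  have key : ∀ ε, 0 < ε → ∀ t, 0 ≤ t → t ≤ 1 → L t ≤ t ^ s + ε ∧ M t ≤ t ^ s + ε := by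
    refine forall_pos_of_contracting (ρ := max (a ^ s) (max (b ^ s) (c ^ s))) (by positivity)
      (by simp [has, hbs, hcs]) ?_ ?_ ?_
    · intro ε δ hεδ hP t h0 h1
      have := hP t h0 h1
      exact ⟨by linarith, by linarith⟩
    · intro t h0 _
      have : 0 ≤ t ^ s := Real.rpow_nonneg h0 s
      exact ⟨by linarith [hL1 t], by linarith [hM1 t]⟩
    · intro ε hε hP t h0 h1
      set ρ := max (a ^ s) (max (b ^ s) (c ^ s))
      have hρa : a ^ s * ε ≤ ρ * ε := mul_le_mul_of_nonneg_right (le_max_left _ _) hε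
      have hρb : b ^ s * ε ≤ ρ * ε :=
        mul_le_mul_of_nonneg_right ((le_max_left _ _).trans (le_max_right _ _)) hε
      have hρc : c ^ s * ε ≤ ρ * ε :=
        mul_le_mul_of_nonneg_right ((le_max_right _ _).trans (le_max_right _ _)) hε
      have hρ : 0 ≤ ρ * ε := le_trans (by positivity) hρa
      have hbound : ∀ N : ℝ → ℝ, (∀ x, N x ≤ 1) → (∀ x, 0 ≤ x → x ≤ 1 → N x ≤ x ^ s + ε) →
          b ^ s * N (t / b) ≤ t ^ s + ρ * ε := by
        intro N hN1 hN
        rcases le_or_gt t b with htb | htb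
        · have h2 := mul_le_mul_of_nonneg_left
            (hN (t / b) (by positivity) ((div_le_one hb).2 htb)) hbs0.le
          rw [mul_add, mul_rpow_div hb h0] at h2
          linarith
        · have h2 := mul_le_mul_of_nonneg_left (hN1 (t / b)) hbs0.le
          have h3 : b ^ s ≤ t ^ s := Real.rpow_le_rpow hb.le htb.le hs0.le
          linarith
      constructor
      · have hLt := hL t
        rcases le_or_gt t (1 - a) with hta | hta
        · have hneg : (t - (1 - a)) / a ≤ 0 := div_nonpos_of_nonpos_of_nonneg (by linarith) ha.le
          have hz := mul_nonpos_of_nonneg_of_nonpos has0.le (hL0 _ hneg)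
          linarith [hbound M (fun x => (hM1 x).trans hh1) fun x hx0 hx1 => (hP x hx0 hx1).2]
        · set ξ := (t - (1 - a)) / a with hξ
          have hξ0 : 0 ≤ ξ := div_nonneg (by linarith) ha.le
          have hξ1 : ξ ≤ 1 := (div_le_one ha).2 (by linarith)
          have htξ : t = (1 - a) + a * ξ := by rw [hξ]; field_simp; ring
          have hconc := rpow_concave_one hs0 hs1 ha.le (by linarith) hξ0
          rw [← htξ] at hconc
          have hξs : 0 ≤ 1 - ξ ^ s := sub_nonneg.2 (Real.rpow_le_one hξ0 hξ1 hs0.le)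
          have e1 := mul_le_mul_of_nonneg_left (hP ξ hξ0 hξ1).1 has0.le
          have f1 := mul_le_mul_of_nonneg_left (hM1 (t / b)) hbs0.le
          have g1 := mul_le_mul_of_nonneg_right haas hξs
          linarith
      · have hMt := hM t
        rcases le_or_gt t (1 - c) with htc | htc
        · have hneg : (t - (1 - c)) / c ≤ 0 := div_nonpos_of_nonpos_of_nonneg (by linarith) hc.le
          have hz := mul_nonpos_of_nonneg_of_nonpos hcs0.le (hM0 _ hneg)
          linarith [hbound L hL1 fun x hx0 hx1 => (hP x hx0 hx1).1]
        · set ξ := (t - (1 - c)) / c with hξ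
          have hξ0 : 0 ≤ ξ := div_nonneg (by linarith) hc.le
          have hξ1 : ξ ≤ 1 := (div_le_one hc).2 (by linarith)
          have htξ : t = (1 - c) + c * ξ := by rw [hξ]; field_simp; ring
          have f1 := mul_le_mul_of_nonneg_left (hL1 (t / b)) hbs0.le
          rcases le_or_gt h (ξ ^ s) with hle | hlt
          · have h2 := mul_le_mul_of_nonneg_left (hM1 ξ) hcs0.le
            have h3 : ξ ^ s ≤ t ^ s := Real.rpow_le_rpow hξ0 (by nlinarith) hs0.le
            linarith
          · have hconc := rpow_concave_one hs0 hs1 hc.le (by linarith) hξ0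
            rw [← htξ] at hconc
            have e1 := mul_le_mul_of_nonneg_left (hP ξ hξ0 hξ1).2 hcs0.le
            have g1 := mul_le_mul_of_nonneg_left hlt.le (sub_nonneg.2 hccs)
            have g2 := mul_le_mul_of_nonneg_left hh1 (show 0 ≤ 1 - c by linarith)
            linarith
  intro t h0 h1
  exact ⟨le_of_forall_pos_le_add fun ε hε => (key ε hε t h0 h1).1,
    le_of_forall_pos_le_add fun ε hε => (key ε hε t h0 h1).2⟩

/-- An interval that straddles the main gap and is shorter than `1` has density below `1`. -/
lemma straddling_lt {a b s k x y : ℝ} (ha : 0 < a) (hb : 0 < b) (hab : a < 1 - b)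
    (hs0 : 0 < s) (hs1 : s < 1) (hk : 1 = a ^ s + k) (hbk : b ≤ k)
    (hx0 : 0 ≤ x) (hx1 : x ≤ 1) (hy0 : 0 ≤ y) (hy1 : y ≤ 1)
    (hne : a * x + (1 - a - b) + b * y < 1) :
    a ^ s * x ^ s + k * y ^ s < (a * x + (1 - a - b) + b * y) ^ s := by
  have haas : a < a ^ s := Real.self_lt_rpow_of_lt_one ha (by linarith) hs1
  have hys : y ^ s ≤ 1 := Real.rpow_le_one hy0 hy1 hs0.le
  rcases hx1.lt_or_eq with hx | rfl
  · have hxs : x ^ s < 1 := Real.rpow_lt_one hx0 hx hs0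
    have hw : 0 < 1 - b := by linarith
    have hconc := (Real.concaveOn_rpow hs0.le hs1.le).2
      (x := ((1 - a / (1 - b)) + a / (1 - b) * x)) (y := y)
      (Set.mem_Ici.2 (add_nonneg (sub_nonneg.2 ((div_le_one hw).2 hab.le)) (by positivity)))
      (Set.mem_Ici.2 hy0) hw.le hb.le (by ring)
    have hconc2 := rpow_concave_one hs0 hs1 (w := a / (1 - b)) (by positivity)
      ((div_le_one hw).2 hab.le) hx0
    have hm := mul_le_mul_of_nonneg_left hconc2 hw.le
    simp only [smul_eq_mul] at hconc
    have e1 : (1 - b) * ((1 - a / (1 - b)) + a / (1 - b) * x) + b * y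
        = a * x + (1 - a - b) + b * y := by field_simp; ring
    have e2 : (1 - b) * ((1 - a / (1 - b)) + a / (1 - b) * x ^ s)
        = a * x ^ s + (1 - a - b) := by field_simp; ring
    rw [e1] at hconc
    rw [e2] at hm
    have g1 := mul_pos (sub_pos.2 haas) (sub_pos.2 hxs)
    have g2 := mul_nonneg (sub_nonneg.2 hbk) (sub_nonneg.2 hys)
    nlinarith
  · have hy : y ≠ 1 := by rintro rfl; linarith
    have hconc := rpow_strictConcave_one hs0 hs1 hb (by linarith) hy0 hy
    have e1 : a * 1 + (1 - a - b) + b * y = (1 - b) + b * y := by ring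
    rw [e1, Real.one_rpow]
    have g2 := mul_nonneg (sub_nonneg.2 hbk) (sub_nonneg.2 hys)
    nlinarith

/-- The `s`-dimensional Hausdorff measure of `F ∩ [l, r]`, as a real number. -/
noncomputable def hausdorffMass (s : ℝ) (F : Set ℝ) (l r : ℝ) : ℝ :=
  (μH[s] (F ∩ Set.Icc l r)).toReal

lemma hausdorffMeasure_affine_image_le {s r : ℝ} (hs : 0 ≤ s) (hr : 0 < r) (t : ℝ) (E : Set ℝ) :
    μH[s] ((fun x => r * x + t) '' E) ≤ ENNReal.ofReal (r ^ s) * μH[s] E := by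
  have hL : LipschitzWith r.toNNReal (fun x : ℝ => r * x + t) := by
    refine LipschitzWith.of_dist_le_mul fun x y => ?_
    rw [Real.coe_toNNReal _ hr.le, Real.dist_eq, Real.dist_eq, ← abs_of_pos hr, ← abs_mul,
      abs_of_pos hr]
    exact le_of_eq (by ring_nf)
  have := hL.hausdorffMeasure_image_le hs E
  rwa [← ENNReal.ofReal.eq_1, ENNReal.ofReal_rpow_of_pos hr] at this

lemma hausdorffMass_le {s h : ℝ} {F : Set ℝ} (h0 : 0 ≤ h) (hF : μH[s] F = ENNReal.ofReal h)
    (l r : ℝ) : hausdorffMass s F l r ≤ h :=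
  ENNReal.toReal_le_of_le_ofReal h0 (hF ▸ measure_mono Set.inter_subset_left)

lemma hausdorffMass_eq_zero {s : ℝ} (hs : 0 < s) {F : Set ℝ} {l r z : ℝ}
    (h : F ∩ Set.Icc l r ⊆ {z}) : hausdorffMass s F l r = 0 := by
  have := Measure.nullSingletonClass_hausdorff ℝ hs
  rw [hausdorffMass, measure_mono_null h (measure_singleton z), ENNReal.toReal_zero]

lemma hausdorffMass_left_of_nonpos {s : ℝ} {F : Set ℝ} (hF : F ⊆ Set.Icc 0 1) {l r : ℝ}
    (hl : l ≤ 0) : hausdorffMass s F l r = hausdorffMass s F 0 r := by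
  rw [hausdorffMass, hausdorffMass]
  congr 2
  ext x
  exact ⟨fun h => ⟨h.1, (hF h.1).1, h.2.2⟩, fun h => ⟨h.1, hl.trans h.2.1, h.2.2⟩⟩

lemma hausdorffMass_right_of_one_le {s : ℝ} {F : Set ℝ} (hF : F ⊆ Set.Icc 0 1) {l r : ℝ}
    (hr : 1 ≤ r) : hausdorffMass s F l r = hausdorffMass s F l 1 := by
  rw [hausdorffMass, hausdorffMass]
  congr 2
  ext x
  exact ⟨fun h => ⟨h.1, h.2.1, (hF h.1).2⟩, fun h => ⟨h.1, h.2.1, h.2.2.trans hr⟩⟩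

lemma hausdorffMass_of_le_zero {s : ℝ} (hs : 0 < s) {F : Set ℝ} (hF : F ⊆ Set.Icc 0 1) {l r : ℝ}
    (hr : r ≤ 0) : hausdorffMass s F l r = 0 :=
  hausdorffMass_eq_zero hs (z := 0) fun _ hx => le_antisymm (hx.2.2.trans hr) (hF hx.1).1

lemma hausdorffMass_of_one_le {s : ℝ} (hs : 0 < s) {F : Set ℝ} (hF : F ⊆ Set.Icc 0 1) {l r : ℝ}
    (hl : 1 ≤ l) : hausdorffMass s F l r = 0 :=
  hausdorffMass_eq_zero hs (z := 1) fun _ hx => le_antisymm (hF hx.1).2 (hl.trans hx.2.1)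

lemma hausdorffMass_union_le {s r₁ t₁ r₂ t₂ hA hB : ℝ} {F A B : Set ℝ} (hs : 0 ≤ s)
    (hr₁ : 0 < r₁) (hr₂ : 0 < r₂)
    (hF : F = (fun x => r₁ * x + t₁) '' A ∪ (fun x => r₂ * x + t₂) '' B)
    (hAfin : μH[s] A = ENNReal.ofReal hA) (hBfin : μH[s] B = ENNReal.ofReal hB) (l r : ℝ) :
    hausdorffMass s F l r ≤ r₁ ^ s * hausdorffMass s A ((l - t₁) / r₁) ((r - t₁) / r₁)
      + r₂ ^ s * hausdorffMass s B ((l - t₂) / r₂) ((r - t₂) / r₂) := by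
  have piece : ∀ (ρ t : ℝ) (E : Set ℝ), 0 < ρ →
      (fun x => ρ * x + t) '' E ∩ Set.Icc l r ⊆
        (fun x => ρ * x + t) '' (E ∩ Set.Icc ((l - t) / ρ) ((r - t) / ρ)) := by
    rintro ρ t E hρ _ ⟨⟨x, hx, rfl⟩, h1, h2⟩
    refine ⟨x, ⟨hx, ?_, ?_⟩, rfl⟩
    · rw [div_le_iff₀ hρ]; linarith
    · rw [le_div_iff₀ hρ]; linarith
  have hsub : μH[s] (F ∩ Set.Icc l r) ≤
      ENNReal.ofReal (r₁ ^ s) * μH[s] (A ∩ Set.Icc ((l - t₁) / r₁) ((r - t₁) / r₁)) +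
      ENNReal.ofReal (r₂ ^ s) * μH[s] (B ∩ Set.Icc ((l - t₂) / r₂) ((r - t₂) / r₂)) := by
    rw [hF, Set.union_inter_distrib_right]
    refine (measure_union_le _ _).trans (add_le_add ?_ ?_)
    · exact (measure_mono (piece r₁ t₁ A hr₁)).trans (hausdorffMeasure_affine_image_le hs hr₁ _ _)
    · exact (measure_mono (piece r₂ t₂ B hr₂)).trans (hausdorffMeasure_affine_image_le hs hr₂ _ _)
  have hA' : μH[s] (A ∩ Set.Icc ((l - t₁) / r₁) ((r - t₁) / r₁)) ≠ ⊤ :=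
    measure_ne_top_of_subset Set.inter_subset_left (hAfin ▸ ENNReal.ofReal_ne_top)
  have hB' : μH[s] (B ∩ Set.Icc ((l - t₂) / r₂) ((r - t₂) / r₂)) ≠ ⊤ :=
    measure_ne_top_of_subset Set.inter_subset_left (hBfin ▸ ENNReal.ofReal_ne_top)
  have hA'' := ENNReal.mul_ne_top (a := ENNReal.ofReal (r₁ ^ s)) ENNReal.ofReal_ne_top hA'
  have hB'' := ENNReal.mul_ne_top (a := ENNReal.ofReal (r₂ ^ s)) ENNReal.ofReal_ne_top hB'
  have := ENNReal.toReal_mono (ENNReal.add_ne_top.2 ⟨hA'', hB''⟩) hsub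
  rwa [ENNReal.toReal_add hA'' hB'', ENNReal.toReal_mul, ENNReal.toReal_mul,
    ENNReal.toReal_ofReal (by positivity), ENNReal.toReal_ofReal (by positivity)] at this

lemma rpow_mul_le_hausdorffMass {s h l r : ℝ} {F : Set ℝ} {T : ℝ → ℝ} (hs : 0 ≤ s) (h0 : 0 ≤ h)
    (hr : 0 < r) (hF : μH[s] F = ENNReal.ofReal h) (hT : ∀ x y, |T x - T y| = r * |x - y|)
    (hTF : T '' F ⊆ F ∩ Set.Icc l (l + r)) : r ^ s * h ≤ hausdorffMass s F l (l + r) := by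
  have hA : AntilipschitzWith (r⁻¹).toNNReal T := by
    refine AntilipschitzWith.of_le_mul_dist fun x y => ?_
    rw [Real.coe_toNNReal _ (inv_nonneg.2 hr.le), Real.dist_eq, Real.dist_eq, hT,
      inv_mul_cancel_left₀ hr.ne']
  have h1 := (hA.le_hausdorffMeasure_image hs F).trans (mul_le_mul_right (measure_mono hTF) _)
  rw [← ENNReal.ofReal.eq_1, ENNReal.ofReal_rpow_of_pos (inv_pos.2 hr), hF] at h1
  have hfin : μH[s] (F ∩ Set.Icc l (l + r)) ≠ ⊤ :=
    measure_ne_top_of_subset Set.inter_subset_left (hF ▸ ENNReal.ofReal_ne_top)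
  have h2 := ENNReal.toReal_mono (ENNReal.mul_ne_top ENNReal.ofReal_ne_top hfin) h1
  rw [ENNReal.toReal_mul, ENNReal.toReal_ofReal h0, ENNReal.toReal_ofReal (by positivity),
    Real.inv_rpow hr.le] at h2
  rwa [le_inv_mul_iff₀ (by positivity)] at h2

lemma similarity_image_subset {r : ℝ} {F : Set ℝ} {T : ℝ → ℝ} (hr : 0 < r)
    (hF : F ⊆ Set.Icc 0 1) (hF0 : (0 : ℝ) ∈ F) (hF1 : (1 : ℝ) ∈ F)
    (hT : ∀ x y, |T x - T y| = r * |x - y|) :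
    ∃ l, l ∈ T '' F ∧ l + r ∈ T '' F ∧ T '' F ⊆ Set.Icc l (l + r) := by
  have h01 := hT 1 0
  rw [sub_zero, abs_one, mul_one] at h01
  have hx : ∀ x ∈ F, |T x - T 0| = r * x ∧ |T x - T 1| = r * (1 - x) := by
    intro x hxF
    rw [hT, hT, sub_zero, abs_of_nonneg (hF hxF).1, abs_sub_comm,
      abs_of_nonneg (sub_nonneg.2 (hF hxF).2)]
    exact ⟨rfl, rfl⟩
  rcases abs_eq hr.le |>.1 h01 with h | h
  · refine ⟨T 0, ⟨0, hF0, rfl⟩, ⟨1, hF1, by linarith⟩, ?_⟩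
    rintro _ ⟨x, hxF, rfl⟩
    obtain ⟨h1, h2⟩ := hx x hxF
    constructor
    · linarith [neg_abs_le (T x - T 1), mul_nonneg hr.le (hF hxF).1]
    · nlinarith [le_abs_self (T x - T 0), (hF hxF).2]
  · refine ⟨T 1, ⟨1, hF1, rfl⟩, ⟨0, hF0, by linarith⟩, ?_⟩
    rintro _ ⟨x, hxF, rfl⟩
    obtain ⟨h1, h2⟩ := hx x hxF
    constructor
    · linarith [neg_abs_le (T x - T 0), mul_nonneg hr.le (sub_nonneg.2 (hF hxF).2)]
    · nlinarith [le_abs_self (T x - T 1), (hF hxF).1]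

theorem stmt19
    (a gu b c gv d : ℝ)
    (ha : 0 < a) (hgu : 0 < gu) (hb : 0 < b) (hc : 0 < c) (hgv : 0 < gv) (hd : 0 < d)
    (hsum1 : a + gu + b = 1) (hsum2 : c + gv + d = 1)
    (Fu Fv : Set ℝ)
    (hFuc : IsCompact Fu) (hFvc : IsCompact Fv)
    (hFu0 : (0 : ℝ) ∈ Fu) (hFu1 : (1 : ℝ) ∈ Fu) (hFusub : Fu ⊆ Set.Icc 0 1)
    (hFv0 : (0 : ℝ) ∈ Fv) (hFv1 : (1 : ℝ) ∈ Fv) (hFvsub : Fv ⊆ Set.Icc 0 1)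
    (hFu : Fu = (fun x => a * x) '' Fu ∪ (fun x => b * x + (a + gu)) '' Fv)
    (hFv : Fv = (fun x => c * x) '' Fv ∪ (fun x => d * x + (c + gv)) '' Fu)
    (hbd : b = d)
    (s : ℝ) (hs0 : 0 < s) (hs1 : s < 1)
    (hdim : (1 - a ^ s) * (1 - c ^ s) = b ^ s * d ^ s)
    (hu hv : ℝ) (hhu0 : 0 < hu) (hhv0 : 0 < hv)
    (hhuH : μH[s] Fu = ENNReal.ofReal hu) (hhvH : μH[s] Fv = ENNReal.ofReal hv)
    (heigu : hu = a ^ s * hu + b ^ s * hv)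
    (heigv : hv = d ^ s * hu + c ^ s * hv)
    (hcond2 : hv ≤ hu)
    (hcond3 : b * a ^ s ≤ (a + gu) * (1 - a ^ s))
    (hind : ∀ m1 m2 m3 m4 m5 : ℤ,
      gu ^ m1 * gv ^ m2 * a ^ m3 * b ^ m4 * c ^ m5 = 1 →
      m1 = 0 ∧ m2 = 0 ∧ m3 = 0 ∧ m4 = 0 ∧ m5 = 0)
    :
    ¬ ∃ (n : ℕ) (T : Fin n → ℝ → ℝ) (rT : Fin n → ℝ),
      2 ≤ n ∧ (∀ i, 0 < rT i ∧ rT i < 1) ∧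
      (∀ i x y, |T i x - T i y| = rT i * |x - y|) ∧
      Fu = ⋃ i, T i '' Fu := by
  rintro ⟨n, T, rT, -, hrT, hT, hU⟩
  subst hbd
  obtain rfl : gu = 1 - a - b := by linarith
  obtain rfl : gv = 1 - c - b := by linarith
  have hsh : ∀ x : ℝ, x + (1 - x - b) = 1 - b := fun x => by ring
  simp only [hsh] at hFu hFv hcond3
  have hFu' : Fu = (fun x => a * x + 0) '' Fu ∪ (fun x => b * x + (1 - b)) '' Fv := by
    simpa using hFu
  have hFv' : Fv = (fun x => c * x + 0) '' Fv ∪ (fun x => b * x + (1 - b)) '' Fu := by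
    simpa using hFv
  have hab : a < 1 - b := by linarith
  have hcb : c < 1 - b := by linarith
  have hbs0 : 0 < b ^ s := Real.rpow_pos_of_pos hb s
  set h := hv / hu with hh
  have hh0 : 0 < h := by positivity
  have hhv : hv = h * hu := by rw [hh]; field_simp
  have heu : 1 = a ^ s + b ^ s * h := by rw [hh]; field_simp; linarith
  have hev : h = b ^ s + c ^ s * h := by rw [hh]; field_simp; linarith
  have hbk : b ≤ b ^ s * h := by
    have : a ^ s = 1 - b ^ s * h := by linarith
    rw [this] at hcond3
    nlinarith
  have hh1 : h < 1 := by
    refine lt_of_le_of_ne ((div_le_one hhu0).2 hcond2) fun h1 => ?_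
    rw [h1] at heu hev
    have hac : a = c := (Real.rpow_left_inj ha.le hc.le hs0.ne').1 (by linarith)
    have := hind 0 0 1 0 (-1) (by rw [hac]; simp [hc.ne'])
    simp at this
  set mu : ℝ → ℝ → ℝ := fun l r => hausdorffMass s Fu l r / hu with hmu
  set mv : ℝ → ℝ → ℝ := fun l r => hausdorffMass s Fv l r / hu with hmv
  have hmu1 : ∀ l r, mu l r ≤ 1 := fun l r =>
    (div_le_one hhu0).2 (hausdorffMass_le hhu0.le hhuH l r)
  have hmv1 : ∀ l r, mv l r ≤ h := fun l r =>
    div_le_div_of_nonneg_right (hausdorffMass_le hhv0.le hhvH l r) hhu0.le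
  have hrelu : ∀ l r, mu l r ≤ a ^ s * mu (l / a) (r / a)
      + b ^ s * mv ((l - (1 - b)) / b) ((r - (1 - b)) / b) := by
    intro l r
    have := hausdorffMass_union_le hs0.le ha hb hFu' hhuH hhvH l r
    simp only [hmu, hmv, ← mul_div_assoc, ← add_div]
    rw [sub_zero, sub_zero] at this
    exact div_le_div_of_nonneg_right this hhu0.le
  have hrelv : ∀ l r, mv l r ≤ c ^ s * mv (l / c) (r / c)
      + b ^ s * mu ((l - (1 - b)) / b) ((r - (1 - b)) / b) := by
    intro l r
    have := hausdorffMass_union_le hs0.le hc hb hFv' hhvH hhuH l r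
    simp only [hmu, hmv, ← mul_div_assoc, ← add_div]
    rw [sub_zero, sub_zero] at this
    exact div_le_div_of_nonneg_right this hhu0.le
  have hul : ∀ l r, l ≤ 0 → mu l r = mu 0 r := fun l r hl => by
    simp only [hmu, hausdorffMass_left_of_nonpos hFusub hl]
  have hvl : ∀ l r, l ≤ 0 → mv l r = mv 0 r := fun l r hl => by
    simp only [hmv, hausdorffMass_left_of_nonpos hFvsub hl]
  have hur : ∀ l r, 1 ≤ r → mu l r = mu l 1 := fun l r hr => by
    simp only [hmu, hausdorffMass_right_of_one_le hFusub hr]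
  have hvr : ∀ l r, 1 ≤ r → mv l r = mv l 1 := fun l r hr => by
    simp only [hmv, hausdorffMass_right_of_one_le hFvsub hr]
  have hu0 : ∀ l r, r ≤ 0 → mu l r = 0 := fun l r hr => by
    simp only [hmu, hausdorffMass_of_le_zero hs0 hFusub hr, zero_div]
  have hv0 : ∀ l r, r ≤ 0 → mv l r = 0 := fun l r hr => by
    simp only [hmv, hausdorffMass_of_le_zero hs0 hFvsub hr, zero_div]
  have hu1 : ∀ l r, 1 ≤ l → mu l r = 0 := fun l r hl => by
    simp only [hmu, hausdorffMass_of_one_le hs0 hFusub hl, zero_div]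
  have hv1 : ∀ l r, 1 ≤ l → mv l r = 0 := fun l r hl => by
    simp only [hmv, hausdorffMass_of_one_le hs0 hFvsub hl, zero_div]
  have hneg : (0 - (1 - b)) / b ≤ 0 := div_nonpos_of_nonpos_of_nonneg (by linarith) hb.le
  have hinit := initial_mass_le (L := mu 0) (M := mv 0) ha hb hc hab hcb hs0 hs1 hh0 hh1.le heu
    hev hbk (hmu1 0) (hmv1 0) (fun t ht => (hu0 0 t ht).le) (fun t ht => (hv0 0 t ht).le)
    (fun t => by
      have := hrelu 0 t
      rwa [zero_div, hvl _ _ hneg] at this)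
    (fun t => by
      have := hrelv 0 t
      rwa [zero_div, hul _ _ hneg] at this)
  have hshift : ∀ t, (1 - t - (1 - b)) / b = 1 - t / b := fun t => by field_simp; ring
  have hshift' : ∀ x t : ℝ, 0 < x → (1 - t) / x = 1 - (t - (1 - x)) / x := fun x t hx => by
    field_simp; ring
  have hone : (1 - (1 - b)) / b = 1 := by field_simp; ring
  have hfin := final_mass_le (L := fun t => mu (1 - t) 1) (M := fun t => mv (1 - t) 1) ha hb hc
    hab hcb hs0 hs1 hh1.le heu hev (fun t => hmu1 _ _) (fun t => hmv1 _ _)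
    (fun t ht => (hu1 (1 - t) 1 (by linarith)).le) (fun t ht => (hv1 (1 - t) 1 (by linarith)).le)
    (fun t => by
      have := hrelu (1 - t) 1
      rwa [hshift, hone, hur _ (1 / a) ((one_le_div ha).2 (by linarith)), hshift' a t ha] at this)
    (fun t => by
      have := hrelv (1 - t) 1
      rwa [hshift, hone, hvr _ (1 / c) ((one_le_div hc).2 (by linarith)), hshift' c t hc] at this)
  have hpFu : 1 - b ∈ Fu := by
    rw [hFu]
    exact Or.inr ⟨0, hFv0, by simp⟩
  have hgap : ∀ x ∈ Fu, x ≤ a ∨ 1 - b ≤ x := by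
    intro x hx
    rw [hFu] at hx
    rcases hx with ⟨y, hy, rfl⟩ | ⟨y, hy, rfl⟩
    · exact Or.inl (by nlinarith [(hFusub hy).2])
    · exact Or.inr (by nlinarith [(hFvsub hy).1])
  obtain ⟨i, hi⟩ := Set.mem_iUnion.1 (hU ▸ hpFu)
  obtain ⟨hr0, hr1⟩ := hrT i
  set r := rT i
  have hTsub : T i '' Fu ⊆ Fu := by
    conv_rhs => rw [hU]
    exact Set.subset_iUnion (fun i => T i '' Fu) i
  obtain ⟨l, hl, hlr, hIcc⟩ := similarity_image_subset hr0 hFusub hFu0 hFu1 (hT i)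
  have hmass : r ^ s ≤ mu l (l + r) := by
    rw [hmu, le_div_iff₀ hhu0]
    exact rpow_mul_le_hausdorffMass hs0.le hhu0.le hr0 hhuH (hT i) (Set.subset_inter hTsub hIcc)
  have hlp := (hIcc hi).1
  have hpr := (hIcc hi).2
  have hl0 := (hFusub (hTsub hl)).1
  have hlr1 := (hFusub (hTsub hlr)).2
  have hrel := hrelu l (l + r)
  set y := (l + r - (1 - b)) / b with hy
  have hy0 : 0 ≤ y := div_nonneg (by linarith) hb.le
  have hy1 : y ≤ 1 := (div_le_one hb).2 (by linarith)
  have hyb : b * y = l + r - (1 - b) := by rw [hy]; field_simp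
  have hv_le : mv ((l - (1 - b)) / b) y ≤ h * y ^ s := by
    rw [hvl _ _ (div_nonpos_of_nonpos_of_nonneg (by linarith) hb.le)]
    exact (hinit y hy0 hy1).2
  have hv_le' := mul_le_mul_of_nonneg_left hv_le hbs0.le
  rcases hgap l (hTsub hl) with hla | hlp'
  · set x := 1 - l / a with hx
    have hla' : l / a ≤ 1 := (div_le_one ha).2 hla
    have hx0 : 0 ≤ x := by linarith
    have hx1 : x ≤ 1 := sub_le_self _ (div_nonneg hl0 ha.le)
    have hxa : a * x = a - l := by rw [hx]; field_simp
    have hu_le : mu (l / a) ((l + r) / a) ≤ x ^ s := by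
      rw [hur _ _ ((one_le_div ha).2 (by linarith)), show l / a = 1 - x by ring]
      exact (hfin x hx0 hx1).1
    have hu_le' := mul_le_mul_of_nonneg_left hu_le (Real.rpow_pos_of_pos ha s).le
    have hlen : a * x + (1 - a - b) + b * y = r := by linarith
    have := straddling_lt ha hb hab hs0 hs1 heu hbk hx0 hx1 hy0 hy1 (by rw [hlen]; exact hr1)
    rw [hlen] at this
    linarith
  · have hyr : b * y = r := by linarith
    rw [hu1 _ _ ((one_le_div ha).2 (by linarith)), mul_zero, zero_add] at hrel
    have hrs : b ^ s * y ^ s = r ^ s := by rw [← Real.mul_rpow hb.le hy0, hyr]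
    have hrs0 : 0 < r ^ s := Real.rpow_pos_of_pos hr0 s
    rw [mul_left_comm, hrs] at hv_le'
    nlinarith
end
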